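/- Let (Λ,F) be an ℝ-building, let m be the direction of a wall of Λ, and let π be a panel at infinity such that some sector-panel belonging to π is contained in a wall with direction m. Then for each asymptotic class D of sector-panels with direction π, there exists a unique wall M of Λ with direction m that contains an element of D. -/

import Mathlib

open Set

noncomputable section

/-- The model space `𝔸`: Euclidean `n`-space. -/
abbrev ModelSpace (n : ℕ) : Type := EuclideanSpace ℝ (Fin n)

/-- A linear reflection of the model space: an involutive isometry, different from the
identity, whose fixed-point set is a linear hyperplane (the kernel of a nonzero linear
functional). -/
def IsLinearReflection {n : ℕ} (s : ModelSpace n ≃ᵢ ModelSpace n) : Prop :=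
  s * s = 1 ∧ s ≠ 1 ∧
    ∃ p : ModelSpace n →ₗ[ℝ] ℝ, p ≠ 0 ∧ {x | s x = x} = {x | p x = 0}

/-- A spherical Coxeter system of rank `n`, realized as a finite reflection group acting
on the model space `ℝⁿ`: a finite set `S` of linear reflections generating a finite
group `W̄`. -/
structure SphericalCoxeterSystem (n : ℕ) where
  S : Set (ModelSpace n ≃ᵢ ModelSpace n)
  finiteS : S.Finite
  refl : ∀ s ∈ S, IsLinearReflection s
  finiteW : Finite ↥(Subgroup.closure S)

namespace SphericalCoxeterSystem

variable {n : ℕ}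

/-- The finite reflection group `W̄` generated by `S`. -/
def Wbar (cs : SphericalCoxeterSystem n) : Subgroup (ModelSpace n ≃ᵢ ModelSpace n) :=
  Subgroup.closure cs.S

/-- A translation of the model space. -/
def IsTranslation (t : ModelSpace n ≃ᵢ ModelSpace n) : Prop :=
  ∃ v : ModelSpace n, ∀ x, t x = x + v

/-- The group `W` of affine transformations generated by `W̄` and all translations. -/
def W (cs : SphericalCoxeterSystem n) : Subgroup (ModelSpace n ≃ᵢ ModelSpace n) :=
  Subgroup.closure (cs.S ∪ {t | IsTranslation t})

/-- An affine reflection: a `W`-conjugate of a generator in `S`. -/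
def IsAffineReflection (cs : SphericalCoxeterSystem n)
    (r : ModelSpace n ≃ᵢ ModelSpace n) : Prop :=
  ∃ s ∈ cs.S, ∃ w ∈ cs.W, r = w * s * w⁻¹

/-- A wall of the model space: the fixed-point set of an affine reflection. -/
def IsModelWall (cs : SphericalCoxeterSystem n) (M : Set (ModelSpace n)) : Prop :=
  ∃ r, cs.IsAffineReflection r ∧ M = {x | r x = x}

/-- A half-apartment of the model space: a closed half-space `H` bounded by the
wall `M` (fixed-point set of the affine reflection `r`). -/
def IsModelHalf (cs : SphericalCoxeterSystem n) (M H : Set (ModelSpace n)) : Prop :=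
  ∃ r, cs.IsAffineReflection r ∧ M = {x | r x = x} ∧
    IsClosed H ∧ Convex ℝ H ∧ H ∪ (⇑r '' H) = univ ∧ H ∩ (⇑r '' H) = M

/-- A sector-face of the model space based at `x`: a closed cell of the arrangement of
all walls through `x` (for each wall through `x` one chooses either the wall itself or
one of its two half-apartments, and takes the intersection of the choices). -/
def IsModelSectorFace (cs : SphericalCoxeterSystem n) (x : ModelSpace n)
    (F : Set (ModelSpace n)) : Prop :=
  F.Nonempty ∧ ∃ σ : Set (ModelSpace n) → Set (ModelSpace n),
    (∀ M, cs.IsModelWall M → x ∈ M → (σ M = M ∨ cs.IsModelHalf M (σ M))) ∧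
    F = ⋂ M ∈ {M | cs.IsModelWall M ∧ x ∈ M}, σ M

/-- A sector of the model space based at `x`: a maximal sector-face based at `x`. -/
def IsModelSector (cs : SphericalCoxeterSystem n) (x : ModelSpace n)
    (F : Set (ModelSpace n)) : Prop :=
  cs.IsModelSectorFace x F ∧ ∀ F', cs.IsModelSectorFace x F' → F ⊆ F' → F' = F

/-- A sector-panel of the model space based at `x`: a sector-face of codimension one. -/
def IsModelSectorPanel (cs : SphericalCoxeterSystem n) (x : ModelSpace n)
    (F : Set (ModelSpace n)) : Prop :=
  cs.IsModelSectorFace x F ∧ Module.finrank ℝ (affineSpan ℝ F).direction = n - 1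

/-- The word length on `W̄` with respect to the generating set `S`. -/
def wordLength (cs : SphericalCoxeterSystem n) (w : ModelSpace n ≃ᵢ ModelSpace n) : ℕ :=
  sInf {k | ∃ l : List (ModelSpace n ≃ᵢ ModelSpace n),
    l.length = k ∧ (∀ s ∈ l, s ∈ cs.S) ∧ l.prod = w}

/-- The longest element of `W̄`. -/
def IsLongest (cs : SphericalCoxeterSystem n) (w : ModelSpace n ≃ᵢ ModelSpace n) : Prop :=
  w ∈ cs.Wbar ∧ ∀ v ∈ cs.Wbar, cs.wordLength v ≤ cs.wordLength w

end SphericalCoxeterSystem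

section Building

variable {n : ℕ} {X : Type*} [MetricSpace X]

/-- Two subsets of a metric space are parallel if their Hausdorff distance is finite. -/
def Par (S T : Set X) : Prop := EMetric.hausdorffEdist S T ≠ ⊤

/-- Two sets locally coincide at `α` (have the same germ at `α`) if their intersection
is a neighbourhood of `α` in both of them. -/
def LocCoin (α : X) (F F' : Set X) : Prop :=
  F ∩ F' ∈ nhdsWithin α F ∧ F ∩ F' ∈ nhdsWithin α F'

variable (cs : SphericalCoxeterSystem n)

/-- An apartment: the image of a chart. -/
def IsApartment (Fc : Set (ModelSpace n → X)) (A : Set X) : Prop :=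
  ∃ f ∈ Fc, A = range f

/-- A sector-face based at `α` : the image under a chart of a sector-face of the model
space, with base point mapped to `α`. -/
def IsSectorFaceAt (Fc : Set (ModelSpace n → X)) (α : X) (F : Set X) : Prop :=
  ∃ f ∈ Fc, ∃ x s, cs.IsModelSectorFace x s ∧ f x = α ∧ F = f '' s

/-- A sector based at `α`. -/
def IsSectorAt (Fc : Set (ModelSpace n → X)) (α : X) (F : Set X) : Prop :=
  ∃ f ∈ Fc, ∃ x s, cs.IsModelSector x s ∧ f x = α ∧ F = f '' s

/-- A sector-panel based at `α`. -/
def IsSectorPanelAt (Fc : Set (ModelSpace n → X)) (α : X) (F : Set X) : Prop :=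
  ∃ f ∈ Fc, ∃ x s, cs.IsModelSectorPanel x s ∧ f x = α ∧ F = f '' s

/-- A sector-face. -/
def IsSectorFace (Fc : Set (ModelSpace n → X)) (F : Set X) : Prop :=
  ∃ α, IsSectorFaceAt cs Fc α F

/-- A sector. -/
def IsSector (Fc : Set (ModelSpace n → X)) (F : Set X) : Prop :=
  ∃ α, IsSectorAt cs Fc α F

/-- A sector-panel. -/
def IsSectorPanel (Fc : Set (ModelSpace n → X)) (F : Set X) : Prop :=
  ∃ α, IsSectorPanelAt cs Fc α F

/-- A wall: the image of a wall of the model space under a chart. -/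
def IsWall (Fc : Set (ModelSpace n → X)) (M : Set X) : Prop :=
  ∃ f ∈ Fc, ∃ m, cs.IsModelWall m ∧ M = f '' m

/-- A half-apartment: the image of a half-apartment of the model space under a chart. -/
def IsHalfApartment (Fc : Set (ModelSpace n → X)) (H : Set X) : Prop :=
  ∃ f ∈ Fc, ∃ m h, cs.IsModelHalf m h ∧ H = f '' h

/-- An ℝ-building of type `(W̄,S)` with set of points `Λ` inside the ambient metric
space `X` (taking `Λ` a subset of an ambient metric space makes it possible to speak of
one ℝ-building being contained in another): a set of isometric charts from the model
space satisfying the axioms (A1)–(A5). -/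
structure RBuilding (cs : SphericalCoxeterSystem n) (X : Type*) [MetricSpace X]
    (Λ : Set X) : Type _ where
  charts : Set (ModelSpace n → X)
  isom : ∀ f ∈ charts, Isometry f
  into : ∀ f ∈ charts, range f ⊆ Λ
  A1 : ∀ f ∈ charts, ∀ w ∈ cs.W, (f ∘ ⇑w) ∈ charts
  A2 : ∀ f ∈ charts, ∀ g ∈ charts,
        IsClosed {x | f x ∈ range g} ∧ Convex ℝ {x | f x ∈ range g} ∧
        ∃ w ∈ cs.W, ∀ x, f x ∈ range g → f x = g (w x)
  A3 : ∀ p ∈ Λ, ∀ q ∈ Λ, ∃ f ∈ charts, p ∈ range f ∧ q ∈ range f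
  A4 : ∀ S₁ S₂, IsSector cs charts S₁ → IsSector cs charts S₂ →
        ∃ T₁ T₂ f, f ∈ charts ∧ IsSector cs charts T₁ ∧ IsSector cs charts T₂ ∧
          T₁ ⊆ S₁ ∧ T₂ ⊆ S₂ ∧ T₁ ⊆ range f ∧ T₂ ⊆ range f
  A5 : ∀ f₁ ∈ charts, ∀ f₂ ∈ charts, ∀ f₃ ∈ charts,
        IsHalfApartment cs charts (range f₁ ∩ range f₂) →
        IsHalfApartment cs charts (range f₂ ∩ range f₃) →
        IsHalfApartment cs charts (range f₁ ∩ range f₃) →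
        (range f₁ ∩ range f₂ ∩ range f₃).Nonempty

/-- The Weyl distance, inside the apartment given by the chart `f`, from the sector `S`
to the sector `S'` (both contained in that apartment): the element `w ∈ W̄` mapping the
sector of the model space based at the origin parallel to `f⁻¹(S)` to the one parallel
to `f⁻¹(S')`. -/
def WeylDistIn (f : ModelSpace n → X) (S S' : Set X)
    (w : ModelSpace n ≃ᵢ ModelSpace n) : Prop :=
  w ∈ cs.Wbar ∧ ∃ s s', cs.IsModelSector 0 s ∧ cs.IsModelSector 0 s' ∧
    Par (f '' s) S ∧ Par (f '' s') S' ∧ ⇑w '' s = s'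

/-- `w` is the Weyl distance from the germ at `α` of the sector `S` to the germ at `α`
of the sector `S'` (both based at `α`): computed via sectors based at `α` with the same
germs lying in a common apartment. -/
def GermWeylDist (Fc : Set (ModelSpace n → X)) (α : X) (S S' : Set X)
    (w : ModelSpace n ≃ᵢ ModelSpace n) : Prop :=
  ∃ f ∈ Fc, ∃ T T', IsSectorAt cs Fc α T ∧ IsSectorAt cs Fc α T' ∧
    T ⊆ range f ∧ T' ⊆ range f ∧ LocCoin α S T ∧ LocCoin α S' T' ∧
    WeylDistIn cs f T T' w

/-- `w` is the Weyl distance between the chambers at infinity represented by the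
sectors `S` and `S'`: computed via parallel sectors lying in a common apartment. -/
def ChamberWeylDist (Fc : Set (ModelSpace n → X)) (S S' : Set X)
    (w : ModelSpace n ≃ᵢ ModelSpace n) : Prop :=
  ∃ f ∈ Fc, ∃ T T', IsSector cs Fc T ∧ IsSector cs Fc T' ∧
    T ⊆ range f ∧ T' ⊆ range f ∧ Par T S ∧ Par T' S' ∧ WeylDistIn cs f T T' w

/-- The germs at `α` of two sectors based at `α` are opposite if their Weyl distance is
the longest element of `W̄`. -/
def OppositeGerms (Fc : Set (ModelSpace n → X)) (α : X) (S S' : Set X) : Prop :=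
  ∃ w, GermWeylDist cs Fc α S S' w ∧ cs.IsLongest w

/-- Two chambers at infinity (represented by the sectors `C`, `D`) are adjacent if they
are distinct and their Weyl distance lies in `S`. -/
def AdjacentChambers (Fc : Set (ModelSpace n → X)) (C D : Set X) : Prop :=
  ¬ Par C D ∧ ∃ s ∈ cs.S, ChamberWeylDist cs Fc C D s

/-- Two sector-panels are asymptotic if they contain a common subset which is itself a
sector-panel. -/
def Asymptotic (Fc : Set (ModelSpace n → X)) (P P' : Set X) : Prop :=
  ∃ Q, IsSectorPanel cs Fc Q ∧ Q ⊆ P ∧ Q ⊆ P'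

/-- An automorphism of an ℝ-building: an isometry `g` of `Λ` with `g ∘ f` a chart for
every chart `f`. -/
def RBuilding.IsAuto {Λ : Set X} (B : RBuilding cs X Λ) (g : ↥Λ ≃ᵢ ↥Λ) : Prop :=
  ∀ f (hf : f ∈ B.charts),
    (fun a : ModelSpace n =>
      ((g ⟨f a, B.into f hf (mem_range_self a)⟩ : ↥Λ) : X)) ∈ B.charts

end Building

section CAT0

/-- `G` is a geodesic segment from `x` to `y`: an isometric image of a closed real
interval with endpoints `x` and `y`. -/
def IsGeodesicSegment {Y : Type*} [MetricSpace Y] (x y : Y) (G : Set Y) : Prop :=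
  ∃ (a b : ℝ) (γ : ℝ → Y), a ≤ b ∧ γ a = x ∧ γ b = y ∧
    (∀ s ∈ Set.Icc a b, ∀ t ∈ Set.Icc a b, dist (γ s) (γ t) = |s - t|) ∧
    G = γ '' Set.Icc a b

/-- A CAT(0) space: a geodesic metric space in which every geodesic triangle satisfies
the CAT(0) comparison inequality with respect to comparison triangles in the Euclidean
plane. -/
def IsCAT0Space (Y : Type*) [MetricSpace Y] : Prop :=
  (∀ x y : Y, ∃ G, IsGeodesicSegment x y G) ∧
  ∀ (x y z : Y) (G : Set Y), IsGeodesicSegment x y G → ∀ a ∈ G,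
    ∀ x' y' z' : EuclideanSpace ℝ (Fin 2),
      dist x' y' = dist x y → dist y' z' = dist y z → dist x' z' = dist x z →
      ∀ a' ∈ segment ℝ x' y', dist x' a' = dist x a → dist z a ≤ dist z' a'

end CAT0

section ModelGeometry

open scoped RealInnerProductSpace
open Filter Topology

/-- An isometry fixing a hyperplane pointwise is the identity or the orthogonal reflection. -/
theorem eq_id_or_reflection_of_fix_hyperplane {E : Type*} [NormedAddCommGroup E]
    [InnerProductSpace ℝ E] {a : E} (ha : ‖a‖ = 1) (l : E →ₗᵢ[ℝ] E)
    (hl : ∀ x, ⟪a, x⟫ = 0 → l x = x) :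
    (∀ x, l x = x) ∨ ∀ x, l x = x - (2 * ⟪a, x⟫) • a := by
  have haa : ⟪a, a⟫ = 1 := by rw [real_inner_self_eq_norm_sq, ha]; norm_num
  have hdec : ∀ x, l x = (x - ⟪a, x⟫ • a) + ⟪a, x⟫ • l a := by
    intro x
    have h : l (x - ⟪a, x⟫ • a) = x - ⟪a, x⟫ • a := by
      apply hl
      rw [inner_sub_right, inner_smul_right, haa]; ring
    rw [map_sub, map_smul] at h
    rw [← h]; abel
  obtain ⟨c, hc⟩ : ∃ c : ℝ, l a = c • a := by
    refine ⟨⟪a, l a⟫, ?_⟩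
    set y := l a - ⟪a, l a⟫ • a with hy
    have hay : ⟪a, y⟫ = 0 := by
      rw [hy, inner_sub_right, inner_smul_right, haa]; ring
    have hly : ⟪l a, y⟫ = 0 := by
      have h := l.inner_map_map a y
      rw [hl y hay, hay] at h
      exact h
    have : ⟪y, y⟫ = 0 := by
      conv_lhs => rw [hy]
      rw [inner_sub_left, hly, inner_smul_left, hay]; simp
    exact sub_eq_zero.mp (inner_self_eq_zero.mp this)
  have hc2 : c = 1 ∨ c = -1 := by
    have h := l.norm_map a
    rw [hc, norm_smul, ha, mul_one, Real.norm_eq_abs] at h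
    exact eq_or_eq_neg_of_abs_eq h
  rcases hc2 with rfl | rfl
  · left; intro x; rw [hdec, hc]; simp
  · right; intro x; rw [hdec, hc]; module

/-- Unit vectors with the same orthogonal hyperplane agree up to sign. -/
theorem eq_or_eq_neg_of_orthogonal_subset {E : Type*} [NormedAddCommGroup E]
    [InnerProductSpace ℝ E] {a b : E} (ha : ‖a‖ = 1) (hb : ‖b‖ = 1)
    (h : ∀ x, ⟪a, x⟫ = 0 → ⟪b, x⟫ = 0) : b = a ∨ b = -a := by
  have haa : ⟪a, a⟫ = 1 := by rw [real_inner_self_eq_norm_sq, ha]; norm_num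
  set y := b - ⟪a, b⟫ • a with hy
  have hay : ⟪a, y⟫ = 0 := by
    rw [hy, inner_sub_right, inner_smul_right, haa]; ring
  have hyy : ⟪y, y⟫ = 0 := by
    conv_lhs => rw [hy]
    rw [inner_sub_left, h y hay, inner_smul_left, hay]; simp
  have hbc : b = ⟪a, b⟫ • a := sub_eq_zero.mp (inner_self_eq_zero.mp hyy)
  generalize ⟪a, b⟫ = c at hbc
  subst hbc
  rw [norm_smul, ha, mul_one, Real.norm_eq_abs] at hb
  rcases eq_or_eq_neg_of_abs_eq hb with rfl | rfl <;> simp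

namespace SphericalCoxeterSystem

variable {n : ℕ} (cs : SphericalCoxeterSystem n)

/-- The linear isometries belonging to the finite reflection group `W̄`. -/
def linW : Set (ModelSpace n ≃ₗᵢ[ℝ] ModelSpace n) := {l | l.toIsometryEquiv ∈ cs.Wbar}

/-- The unit normals of the walls through the origin. -/
def roots : Set (ModelSpace n) := {a | ‖a‖ = 1 ∧ cs.IsModelWall {x | ⟪a, x⟫ = 0}}

variable {cs}

theorem Wbar_le_W : cs.Wbar ≤ cs.W := Subgroup.closure_mono subset_union_left

theorem addRight_mem_W (u : ModelSpace n) : IsometryEquiv.addRight u ∈ cs.W :=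
  Subgroup.subset_closure (Or.inr ⟨u, fun _ => rfl⟩)

theorem exists_linear_of_mem_Wbar {w : ModelSpace n ≃ᵢ ModelSpace n} (hw : w ∈ cs.Wbar) :
    ∃ l ∈ cs.linW, l.toIsometryEquiv = w := by
  have h0 : w 0 = 0 := by
    refine Subgroup.closure_induction (p := fun w _ => w 0 = 0) ?_ rfl ?_ ?_ hw
    · intro s hs
      obtain ⟨-, -, p, -, hp⟩ := cs.refl s hs
      have : (0 : ModelSpace n) ∈ {x | s x = x} := by rw [hp]; simp
      exact this
    · intro x y _ _ hx hy
      rw [IsometryEquiv.mul_apply, hy, hx]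
    · intro x _ hx
      conv_lhs => rw [← hx]
      exact IsometryEquiv.inv_apply_self x 0
  have he : (w.toRealLinearIsometryEquivOfMapZero h0).toIsometryEquiv = w := by
    ext x; rfl
  refine ⟨w.toRealLinearIsometryEquivOfMapZero h0, ?_, he⟩
  change _ ∈ cs.Wbar
  rwa [he]

theorem refl_mem_linW : LinearIsometryEquiv.refl ℝ (ModelSpace n) ∈ cs.linW := by
  change _ ∈ cs.Wbar
  exact cs.Wbar.one_mem

theorem trans_mem_linW {l k : ModelSpace n ≃ₗᵢ[ℝ] ModelSpace n} (hl : l ∈ cs.linW)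
    (hk : k ∈ cs.linW) : l.trans k ∈ cs.linW :=
  cs.Wbar.mul_mem hk hl

theorem symm_mem_linW {l : ModelSpace n ≃ₗᵢ[ℝ] ModelSpace n} (hl : l ∈ cs.linW) :
    l.symm ∈ cs.linW :=
  cs.Wbar.inv_mem hl

theorem exists_affine_of_mem_W {w : ModelSpace n ≃ᵢ ModelSpace n} (hw : w ∈ cs.W) :
    ∃ l ∈ cs.linW, ∃ u, ∀ x, w x = l x + u := by
  refine Subgroup.closure_induction
    (p := fun w _ => ∃ l ∈ cs.linW, ∃ u, ∀ x, w x = l x + u) ?_ ?_ ?_ ?_ hw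
  · rintro s (hs | ⟨u, hu⟩)
    · obtain ⟨l, hl, rfl⟩ := exists_linear_of_mem_Wbar (cs := cs) (Subgroup.subset_closure hs)
      exact ⟨l, hl, 0, fun x => by simp⟩
    · exact ⟨_, refl_mem_linW, u, hu⟩
  · exact ⟨_, refl_mem_linW, 0, fun x => by simp⟩
  · rintro x y - - ⟨l, hl, u, hu⟩ ⟨k, hk, v, hv⟩
    refine ⟨k.trans l, trans_mem_linW hk hl, l v + u, fun z => ?_⟩
    rw [IsometryEquiv.mul_apply, hv, hu, map_add, add_assoc]; rfl
  · rintro x - ⟨l, hl, u, hu⟩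
    refine ⟨l.symm, symm_mem_linW hl, -l.symm u, fun z => ?_⟩
    apply x.injective
    rw [IsometryEquiv.apply_inv_self, hu]
    simp

theorem affine_mem_W {l : ModelSpace n ≃ₗᵢ[ℝ] ModelSpace n} (hl : l ∈ cs.linW)
    (u : ModelSpace n) : l.toIsometryEquiv.trans (IsometryEquiv.addRight u) ∈ cs.W :=
  cs.W.mul_mem (addRight_mem_W u) (Wbar_le_W hl)

theorem isModelWall_preimage {M : Set (ModelSpace n)} (hM : cs.IsModelWall M)
    {g : ModelSpace n ≃ᵢ ModelSpace n} (hg : g ∈ cs.W) : cs.IsModelWall (g ⁻¹' M) := by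
  obtain ⟨r, ⟨s, hs, w, hw, rfl⟩, rfl⟩ := hM
  refine ⟨_, ⟨s, hs, g⁻¹ * w, cs.W.mul_mem (cs.W.inv_mem hg) hw, rfl⟩, ?_⟩
  ext x
  simp only [mem_preimage, mem_ofPred_eq]
  rw [mul_inv_rev, inv_inv]
  simp only [IsometryEquiv.mul_apply]
  rw [← IsometryEquiv.apply_inv_self g (w (s (w⁻¹ (g x))))]
  rw [g.injective.eq_iff]
  simp

theorem neg_mem_roots {a : ModelSpace n} (ha : a ∈ cs.roots) : -a ∈ cs.roots := by
  refine ⟨by rw [norm_neg]; exact ha.1, ?_⟩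
  simpa [inner_neg_left] using ha.2

theorem inner_self_of_mem_roots {a : ModelSpace n} (ha : a ∈ cs.roots) : ⟪a, a⟫ = 1 := by
  rw [real_inner_self_eq_norm_sq, ha.1]; norm_num

theorem map_mem_roots {a : ModelSpace n} (ha : a ∈ cs.roots)
    {l : ModelSpace n ≃ₗᵢ[ℝ] ModelSpace n} (hl : l ∈ cs.linW) : l a ∈ cs.roots := by
  refine ⟨by rw [l.norm_map]; exact ha.1, ?_⟩
  convert isModelWall_preimage ha.2 (Wbar_le_W (symm_mem_linW hl)) using 1
  ext x
  change ⟪l a, x⟫ = 0 ↔ ⟪a, l.symm x⟫ = 0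
  conv_lhs => rw [← l.apply_symm_apply x]
  rw [l.inner_map_map]

theorem isModelWall_iff {M : Set (ModelSpace n)} :
    cs.IsModelWall M ↔ ∃ a ∈ cs.roots, ∃ c : ℝ, M = {x | ⟪a, x⟫ = c} := by
  constructor
  · rintro ⟨r, ⟨s, hs, w, hw, rfl⟩, rfl⟩
    obtain ⟨-, -, p, hp0, hp⟩ := cs.refl s hs
    obtain ⟨b, hb⟩ : ∃ b : ModelSpace n, ∀ x, p x = ⟪b, x⟫ :=
      ⟨(InnerProductSpace.toDual ℝ (ModelSpace n)).symm (LinearMap.toContinuousLinearMap p),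
        fun x => by simp⟩
    have hb0 : b ≠ 0 := by
      rintro rfl
      exact hp0 (LinearMap.ext fun x => by simp [hb])
    have hb1 : ‖b‖ ≠ 0 := norm_ne_zero_iff.mpr hb0
    set a := (‖b‖)⁻¹ • b with ha
    have hpa : ∀ x, s x = x ↔ ⟪a, x⟫ = 0 := by
      intro x
      have : s x = x ↔ p x = 0 := Set.ext_iff.mp hp x
      rw [this, hb, ha, inner_smul_left]
      simp [hb0]
    have har : a ∈ cs.roots := by
      refine ⟨by rw [ha, norm_smul, norm_inv, norm_norm, inv_mul_cancel₀ hb1], s,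
        ⟨s, hs, 1, cs.W.one_mem, by simp⟩, ?_⟩
      ext x; exact (hpa x).symm
    obtain ⟨l, hl, u, hu⟩ := exists_affine_of_mem_W hw
    refine ⟨l a, map_mem_roots har hl, ⟪l a, u⟫, ?_⟩
    ext x
    simp only [mem_ofPred_eq, IsometryEquiv.mul_apply]
    conv_lhs => rhs; rw [← IsometryEquiv.apply_inv_self w x]
    rw [w.injective.eq_iff, hpa]
    conv_rhs => lhs; rw [← IsometryEquiv.apply_inv_self w x]
    rw [hu, inner_add_right, l.inner_map_map]
    simp
  · rintro ⟨a, ha, c, rfl⟩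
    convert isModelWall_preimage ha.2 (addRight_mem_W (-(c • a))) using 1
    ext x
    change ⟪a, x⟫ = c ↔ ⟪a, x + -(c • a)⟫ = 0
    rw [inner_add_right, inner_neg_right, inner_smul_right, inner_self_of_mem_roots ha]
    constructor <;> intro h <;> linarith

theorem affineReflection_apply {r : ModelSpace n ≃ᵢ ModelSpace n} (hr : cs.IsAffineReflection r)
    {a : ModelSpace n} (ha : ‖a‖ = 1) {c : ℝ} (hM : {x | ⟪a, x⟫ = c} = {x | r x = x}) :
    ∀ x, r x = x - (2 * (⟪a, x⟫ - c)) • a := by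
  have haa : ⟪a, a⟫ = 1 := by rw [real_inner_self_eq_norm_sq, ha]; norm_num
  have hrW : r ∈ cs.W := by
    obtain ⟨s, hs, w, hw, rfl⟩ := hr
    exact cs.W.mul_mem (cs.W.mul_mem hw (Wbar_le_W (Subgroup.subset_closure hs)))
      (cs.W.inv_mem hw)
  obtain ⟨l, -, u, hu⟩ := exists_affine_of_mem_W hrW
  have hfix : ∀ x, ⟪a, x⟫ = c ↔ l x + u = x := fun x => by
    rw [← hu]; exact Set.ext_iff.mp hM x
  have hca : l (c • a) + u = c • a := (hfix _).mp (by rw [inner_smul_right, haa, mul_one])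
  have hl : ∀ x, ⟪a, x⟫ = 0 → l x = x := by
    intro x hx
    have h := (hfix (c • a + x)).mp (by rw [inner_add_right, inner_smul_right, haa, hx]; ring)
    rw [map_add] at h
    have : l x = (l (c • a) + l x + u) - (l (c • a) + u) := by abel
    rw [this, h, hca]; abel
  have key : ∀ x, r x = l (x - c • a) + c • a := by
    intro x
    rw [hu, map_sub, ← sub_eq_of_eq_add' hca.symm]; abel
  rcases eq_id_or_reflection_of_fix_hyperplane ha l.toLinearIsometry hl with h | h
  · exfalso
    have h1 : ∀ x, ⟪a, x⟫ = c := by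
      intro x
      rw [hfix, ← hu, key]
      have := h (x - c • a)
      simp only [LinearIsometryEquiv.coe_toLinearIsometry] at this
      rw [this]; abel
    have h2 := h1 0
    have h3 := h1 a
    rw [haa, ← h2, inner_zero_right] at h3
    norm_num at h3
  · intro x
    have := h (x - c • a)
    simp only [LinearIsometryEquiv.coe_toLinearIsometry] at this
    rw [key, this, inner_sub_right, inner_smul_right, haa]; module

theorem exists_affineReflection {a : ModelSpace n} (ha : a ∈ cs.roots) (c : ℝ) :
    ∃ r, cs.IsAffineReflection r ∧ {x | ⟪a, x⟫ = c} = {x | r x = x} ∧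
      ∀ x, r x = x - (2 * (⟪a, x⟫ - c)) • a := by
  obtain ⟨r, hr, hM⟩ := isModelWall_iff.mpr ⟨a, ha, c, rfl⟩
  exact ⟨r, hr, hM, affineReflection_apply hr ha.1 hM⟩

theorem mem_Wbar_of_map_zero {w : ModelSpace n ≃ᵢ ModelSpace n} (hw : w ∈ cs.W) (h0 : w 0 = 0) :
    w ∈ cs.Wbar := by
  obtain ⟨l, hl, u, hu⟩ := exists_affine_of_mem_W hw
  have hu0 : u = 0 := by have := hu 0; rw [h0, map_zero, zero_add] at this; exact this.symm
  have : w = l.toIsometryEquiv := by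
    ext1 x; rw [hu, hu0, add_zero]; rfl
  rw [this]; exact hl

theorem IsAffineReflection.mem_W {r : ModelSpace n ≃ᵢ ModelSpace n}
    (hr : cs.IsAffineReflection r) : r ∈ cs.W := by
  obtain ⟨s, hs, w, hw, rfl⟩ := hr
  exact cs.W.mul_mem (cs.W.mul_mem hw (Wbar_le_W (Subgroup.subset_closure hs)))
    (cs.W.inv_mem hw)

theorem exists_reflection {a : ModelSpace n} (ha : a ∈ cs.roots) :
    ∃ ρ ∈ cs.linW, ∀ x, ρ x = x - (2 * ⟪a, x⟫) • a := by
  obtain ⟨r, hr, -, hr'⟩ := exists_affineReflection ha 0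
  obtain ⟨l, hl, rfl⟩ := exists_linear_of_mem_Wbar
    (mem_Wbar_of_map_zero hr.mem_W (by rw [hr']; simp))
  refine ⟨l, hl, fun x => ?_⟩
  have := hr' x
  rw [sub_zero] at this
  exact this

theorem roots_finite : cs.roots.Finite := by
  have : Finite cs.Wbar := cs.finiteW
  have hW : (cs.Wbar : Set (ModelSpace n ≃ᵢ ModelSpace n)).Finite := Set.toFinite _
  have hsub : cs.roots ⊆ ⋃ r ∈ (cs.Wbar : Set (ModelSpace n ≃ᵢ ModelSpace n)),
      {a | ‖a‖ = 1 ∧ {x | ⟪a, x⟫ = 0} = {x | r x = x}} := by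
    intro a ha
    obtain ⟨r, hr, hM, hr'⟩ := exists_affineReflection ha 0
    exact mem_biUnion (mem_Wbar_of_map_zero hr.mem_W (by rw [hr']; simp)) ⟨ha.1, hM⟩
  refine (hW.biUnion fun r _ => ?_).subset hsub
  by_cases h : ∃ a : ModelSpace n, ‖a‖ = 1 ∧ {x | ⟪a, x⟫ = 0} = {x | r x = x}
  · obtain ⟨a, ha, hM⟩ := h
    refine (Set.toFinite {a, -a}).subset ?_
    rintro b ⟨hb, hM'⟩
    exact eq_or_eq_neg_of_orthogonal_subset ha hb fun x hx => by
      have : x ∈ {x | ⟪b, x⟫ = 0} := by rw [hM', ← hM]; exact hx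
      exact this
  · convert Set.finite_empty
    ext a
    simp only [mem_ofPred_eq, mem_empty_iff_false, iff_false]
    exact fun ha => h ⟨a, ha⟩

theorem isModelHalf_ge {a : ModelSpace n} (ha : a ∈ cs.roots) (c : ℝ) :
    cs.IsModelHalf {x | ⟪a, x⟫ = c} {x | c ≤ ⟪a, x⟫} := by
  obtain ⟨r, hr, hM, hr'⟩ := exists_affineReflection ha c
  have hrr : ∀ x, r (r x) = x := by
    intro x
    rw [hr' (r x), hr' x, inner_sub_right, inner_smul_right, inner_self_of_mem_roots ha]
    module
  have him : r '' {x | c ≤ ⟪a, x⟫} = {x | ⟪a, x⟫ ≤ c} := by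
    ext x
    have hx : ⟪a, r x⟫ = 2 * c - ⟪a, x⟫ := by
      rw [hr', inner_sub_right, inner_smul_right, inner_self_of_mem_roots ha]; ring
    constructor
    · rintro ⟨y, hy, rfl⟩
      have hy' : ⟪a, r y⟫ = 2 * c - ⟪a, y⟫ := by
        rw [hr', inner_sub_right, inner_smul_right, inner_self_of_mem_roots ha]; ring
      simp only [mem_ofPred_eq] at hy ⊢
      linarith
    · intro h
      refine ⟨r x, ?_, hrr x⟩
      simp only [mem_ofPred_eq] at h ⊢
      linarith
  refine ⟨r, hr, hM, isClosed_le continuous_const (by fun_prop), ?_, ?_, ?_⟩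
  · exact convex_halfSpace_ge
      ⟨fun x y => inner_add_right _ _ _, fun c x => inner_smul_right _ _ _⟩ c
  · rw [him]; ext x; simp [le_total]
  · rw [him]; ext x; simp only [mem_inter_iff, mem_ofPred_eq]
    constructor
    · rintro ⟨h, h'⟩; linarith
    · intro h; constructor <;> linarith

theorem isModelHalf_cases {M H : Set (ModelSpace n)} (hH : cs.IsModelHalf M H)
    {a : ModelSpace n} (ha : a ∈ cs.roots) {c : ℝ} (hMa : M = {x | ⟪a, x⟫ = c}) :
    H = {x | c ≤ ⟪a, x⟫} ∨ H = {x | ⟪a, x⟫ ≤ c} := by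
  obtain ⟨r, hr, hM, -, hconv, hun, h_inter⟩ := hH
  have hr' := affineReflection_apply hr ha.1 (hMa ▸ hM)
  have haa := inner_self_of_mem_roots ha
  have hrr : ∀ x, r (r x) = x := by
    intro x
    rw [hr' (r x), hr' x, inner_sub_right, inner_smul_right, haa]; module
  have hra : ∀ x, ⟪a, r x⟫ = 2 * c - ⟪a, x⟫ := by
    intro x
    rw [hr', inner_sub_right, inner_smul_right, haa]; ring
  have hMH : M ⊆ H := by rw [← h_inter]; exact inter_subset_left
  have h1 : ∀ x ∈ H, r x ∈ H → ⟪a, x⟫ = c := by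
    intro x hx hrx
    have : x ∈ M := by rw [← h_inter]; exact ⟨hx, r x, hrx, hrr x⟩
    rwa [hMa] at this
  have h2 : ∀ x, x ∈ H ∨ r x ∈ H := by
    intro x
    have : x ∈ H ∪ r '' H := by rw [hun]; trivial
    rcases this with h | ⟨y, hy, rfl⟩
    · exact Or.inl h
    · right; rwa [hrr]
  -- points of `H` on both sides of the wall yield a point `z` with `z, r z ∈ H`
  have h3 : ∀ x ∈ H, ∀ y ∈ H, c < ⟪a, x⟫ → ⟪a, y⟫ < c → False := by
    intro x hx y hy hxc hyc
    have hstrip : ∀ p ∈ H, ∀ z, ∀ t : ℝ, 0 < t → t < 1 → ⟪a, z⟫ - c = t * (⟪a, p⟫ - c) →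
        z ∈ H := by
      intro p hp z t ht0 ht1 hz
      have hq : (1 - t)⁻¹ • (z - t • p) ∈ H := by
        apply hMH
        rw [hMa]
        simp only [mem_ofPred_eq]
        rw [inner_smul_right, inner_sub_right, inner_smul_right]
        have : 1 - t ≠ 0 := by linarith
        field_simp
        linarith
      have := hconv hp hq ht0.le (by linarith : 0 ≤ 1 - t) (by ring)
      rwa [smul_inv_smul₀ (by linarith : 1 - t ≠ 0), add_sub_cancel] at this
    set α := ⟪a, x⟫ - c with hα
    set β := c - ⟪a, y⟫ with hβ
    have hα0 : 0 < α := by linarith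
    have hβ0 : 0 < β := by linarith
    set ε := min α β / 2 with hε
    have hε0 : 0 < ε := by positivity
    have hεα : ε < α := by linarith [min_le_left α β]
    have hεβ : ε < β := by linarith [min_le_right α β]
    set z := (c + ε) • a with hz
    have hza : ⟪a, z⟫ = c + ε := by rw [hz, inner_smul_right, haa, mul_one]
    have hzH : z ∈ H := hstrip x hx z (ε / α) (by positivity) (by rwa [div_lt_one hα0])
      (by rw [hza, ← hα]; field_simp; ring)
    have hrzH : r z ∈ H := hstrip y hy (r z) (ε / β) (by positivity)
      (by rwa [div_lt_one hβ0])
      (by rw [hra, hza, show ⟪a, y⟫ - c = -β by rw [hβ]; ring]; field_simp; ring)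
    have := h1 z hzH hrzH
    linarith
  by_cases hpos : ∃ x ∈ H, c < ⟪a, x⟫
  · left
    obtain ⟨x, hx, hxc⟩ := hpos
    ext y
    constructor
    · intro hy
      by_contra hyc
      exact h3 x hx y hy hxc (not_le.mp hyc)
    · intro hy
      rcases h2 y with h | h
      · exact h
      · rcases (show c ≤ ⟪a, y⟫ from hy).eq_or_lt with h' | h'
        · exact hMH (by rw [hMa]; exact h'.symm)
        · exact (h3 x hx _ h hxc (by rw [hra]; linarith)).elim
  · right
    push Not at hpos
    ext y
    refine ⟨hpos y, fun hy => ?_⟩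
    rcases h2 y with h | h
    · exact h
    · have := hpos _ h
      rw [hra] at this
      have hyc : ⟪a, y⟫ ≤ c := hy
      exact hMH (by rw [hMa]; simp only [mem_ofPred_eq]; linarith)

theorem isModelHalf_le {a : ModelSpace n} (ha : a ∈ cs.roots) (c : ℝ) :
    cs.IsModelHalf {x | ⟪a, x⟫ = c} {x | ⟪a, x⟫ ≤ c} := by
  have := isModelHalf_ge (neg_mem_roots ha) (-c)
  simpa only [inner_neg_left, neg_inj, neg_le_neg_iff] using this

end SphericalCoxeterSystem

end ModelGeometry

section Faces

open scoped RealInnerProductSpace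
open Filter Topology

namespace SphericalCoxeterSystem

variable {n : ℕ} (cs : SphericalCoxeterSystem n)

/-- The sector-face based at the origin that contains `ξ` in its relative interior. -/
def face (ξ : ModelSpace n) : Set (ModelSpace n) :=
  {y | ∀ b ∈ cs.roots, 0 ≤ ⟪b, ξ⟫ → 0 ≤ ⟪b, y⟫}

/-- A vector is generic if it lies on no wall through the origin. -/
def Generic (v : ModelSpace n) : Prop := ∀ b ∈ cs.roots, ⟪b, v⟫ ≠ 0

/-- `ξ` spans a sector-panel lying in the wall with unit normal `a`. -/
structure IsPanelVector (ξ a : ModelSpace n) : Prop where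
  mem : a ∈ cs.roots
  inner_eq_zero : ⟪a, ξ⟫ = 0
  eq_or_eq_neg : ∀ b ∈ cs.roots, ⟪b, ξ⟫ = 0 → b = a ∨ b = -a

variable {cs} {ξ η v a x y : ModelSpace n}

theorem self_mem_face : ξ ∈ cs.face ξ := fun _ _ h => h

theorem zero_mem_face : (0 : ModelSpace n) ∈ cs.face ξ := fun _ _ _ => by simp

theorem add_mem_face (hx : x ∈ cs.face ξ) (hy : y ∈ cs.face ξ) : x + y ∈ cs.face ξ :=
  fun b hb h => by rw [inner_add_right]; exact add_nonneg (hx b hb h) (hy b hb h)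

theorem smul_mem_face {t : ℝ} (ht : 0 ≤ t) (hx : x ∈ cs.face ξ) : t • x ∈ cs.face ξ :=
  fun b hb h => by rw [inner_smul_right]; exact mul_nonneg ht (hx b hb h)

theorem face_subset_face (h : η ∈ cs.face ξ) : cs.face η ⊆ cs.face ξ :=
  fun _ hy b hb hbξ => hy b hb (h b hb hbξ)

theorem inner_eq_zero_of_mem_face (ha : a ∈ cs.roots) (h : ⟪a, ξ⟫ = 0) (hy : y ∈ cs.face ξ) :
    ⟪a, y⟫ = 0 := by
  have h1 := hy a ha h.ge
  have h2 := hy (-a) (neg_mem_roots ha) (by rw [inner_neg_left, h, neg_zero])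
  rw [inner_neg_left] at h2
  linarith

theorem Generic.face_subset_face (hv : cs.Generic v) (h : v ∈ cs.face η) :
    cs.face η ⊆ cs.face v := by
  intro y hy b hb hbv
  apply hy b hb
  by_contra hbη
  have := h (-b) (neg_mem_roots hb) (by rw [inner_neg_left]; linarith)
  rw [inner_neg_left] at this
  exact hv b hb (by linarith)

theorem Generic.neg (hv : cs.Generic v) : cs.Generic (-v) := fun b hb => by
  rw [inner_neg_right]; exact neg_ne_zero.mpr (hv b hb)

theorem map_mem_face {l : ModelSpace n ≃ₗᵢ[ℝ] ModelSpace n} (hl : l ∈ cs.linW)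
    (hy : y ∈ cs.face ξ) : l y ∈ cs.face (l ξ) := by
  intro b hb h
  have hb' := map_mem_roots hb (symm_mem_linW hl)
  have key : ∀ z, ⟪b, l z⟫ = ⟪l.symm b, z⟫ := fun z => by
    rw [← l.inner_map_map (l.symm b), l.apply_symm_apply]
  rw [key] at h ⊢
  exact hy _ hb' h

theorem map_mem_face_iff {l : ModelSpace n ≃ₗᵢ[ℝ] ModelSpace n} (hl : l ∈ cs.linW) :
    l y ∈ cs.face (l ξ) ↔ y ∈ cs.face ξ :=
  ⟨fun h => by simpa using map_mem_face (symm_mem_linW hl) h, map_mem_face hl⟩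

theorem Generic.map (hv : cs.Generic v) {l : ModelSpace n ≃ₗᵢ[ℝ] ModelSpace n}
    (hl : l ∈ cs.linW) : cs.Generic (l v) := by
  intro b hb
  have : ⟪b, l v⟫ = ⟪l.symm b, v⟫ := by
    rw [← l.inner_map_map (l.symm b), l.apply_symm_apply]
  rw [this]
  exact hv _ (map_mem_roots hb (symm_mem_linW hl))

theorem eventually_inner_pos (x : ModelSpace n) :
    ∀ᶠ y in 𝓝 x, ∀ b ∈ cs.roots, 0 < ⟪b, x⟫ → 0 < ⟪b, y⟫ := by
  refine (eventually_all_finite roots_finite).mpr fun b _ => ?_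
  by_cases h : 0 < ⟪b, x⟫
  · have : Tendsto (fun y : ModelSpace n => ⟪b, y⟫) (𝓝 x) (𝓝 ⟪b, x⟫) :=
      Continuous.tendsto (by fun_prop) x
    filter_upwards [this.eventually (lt_mem_nhds h)] with y hy _ using hy
  · exact Eventually.of_forall fun y h' => (h h').elim

theorem eventually_mem_face (x : ModelSpace n) : ∀ᶠ y in 𝓝 x, x ∈ cs.face y := by
  filter_upwards [eventually_inner_pos (cs := cs) x] with y hy b hb hby
  by_contra h
  have := hy (-b) (neg_mem_roots hb) (by rw [inner_neg_left]; linarith)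
  rw [inner_neg_left] at this
  linarith

theorem Generic.eventually_mem_face (hv : cs.Generic v) : ∀ᶠ y in 𝓝 v, y ∈ cs.face v := by
  filter_upwards [eventually_inner_pos (cs := cs) v] with y hy b hb hbv
  exact (hy b hb (lt_of_le_of_ne hbv (hv b hb).symm)).le

theorem tendsto_add_smul (ξ u : ModelSpace n) :
    Tendsto (fun ε : ℝ => ξ + ε • u) (𝓝[>] 0) (𝓝 ξ) := by
  have : Tendsto (fun ε : ℝ => ξ + ε • u) (𝓝 0) (𝓝 (ξ + (0 : ℝ) • u)) :=
    Continuous.tendsto (by fun_prop) 0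
  rw [zero_smul, add_zero] at this
  exact this.mono_left nhdsWithin_le_nhds

theorem eventually_generic_add_smul {u : ModelSpace n}
    (hu : ∀ b ∈ cs.roots, ⟪b, ξ⟫ = 0 → ⟪b, u⟫ ≠ 0) :
    ∀ᶠ ε : ℝ in 𝓝[>] 0, cs.Generic (ξ + ε • u) ∧ cs.face ξ ⊆ cs.face (ξ + ε • u) := by
  filter_upwards [(tendsto_add_smul ξ u).eventually (eventually_inner_pos (cs := cs) ξ),
    (tendsto_add_smul ξ u).eventually (cs.eventually_mem_face ξ), self_mem_nhdsWithin]
    with ε h1 h2 hε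
  refine ⟨fun b hb => ?_, SphericalCoxeterSystem.face_subset_face h2⟩
  rcases lt_trichotomy ⟪b, ξ⟫ 0 with h | h | h
  · have := h1 (-b) (neg_mem_roots hb) (by rw [inner_neg_left]; linarith)
    rw [inner_neg_left] at this
    linarith
  · rw [inner_add_right, h, inner_smul_right, zero_add]
    exact mul_ne_zero (ne_of_gt hε) (hu b hb h)
  · exact (h1 b hb h).ne'

theorem exists_generic : ∃ v, cs.Generic v := by
  have : Finite cs.roots := roots_finite
  obtain ⟨x, hx⟩ := Module.Dual.exists_forall_ne_zero_of_forall_exists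
    (fun b : cs.roots => (innerₛₗ ℝ (b : ModelSpace n) : ModelSpace n →ₗ[ℝ] ℝ))
    (fun b => ⟨b, by
      change ⟪(b : ModelSpace n), b⟫ ≠ 0
      rw [inner_self_of_mem_roots b.2]; norm_num⟩)
  exact ⟨x, fun b hb => hx ⟨b, hb⟩⟩

theorem exists_generic_face_superset (ξ : ModelSpace n) :
    ∃ v, cs.Generic v ∧ cs.face ξ ⊆ cs.face v := by
  obtain ⟨u, hu⟩ := exists_generic (cs := cs)
  obtain ⟨ε, hε⟩ := (eventually_generic_add_smul (ξ := ξ) (u := u) fun b hb _ => hu b hb).exists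
  exact ⟨_, hε⟩

theorem exists_generic_mem_face (x : ModelSpace n) : ∃ v, cs.Generic v ∧ x ∈ cs.face v := by
  obtain ⟨v, hv, h⟩ := exists_generic_face_superset (cs := cs) x
  exact ⟨v, hv, h self_mem_face⟩

theorem eventually_smul_add_mem_face (hy : ∀ b ∈ cs.roots, ⟪b, ξ⟫ = 0 → ⟪b, y⟫ = 0) :
    ∀ᶠ t : ℝ in atTop, t • ξ + y ∈ cs.face ξ := by
  have h0 : Tendsto (fun t : ℝ => ξ + t⁻¹ • y) atTop (𝓝 ξ) :=
    (tendsto_add_smul ξ y).comp tendsto_inv_atTop_nhdsGT_zero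
  filter_upwards [h0.eventually (eventually_inner_pos (cs := cs) ξ), eventually_gt_atTop 0]
    with t ht ht0 b hb hbξ
  rcases hbξ.eq_or_lt with h | h
  · rw [inner_add_right, inner_smul_right, ← h, hy b hb h.symm]; simp
  · have h1 := ht b hb h
    have : t • ξ + y = t • (ξ + t⁻¹ • y) := by
      rw [smul_add, smul_inv_smul₀ ht0.ne']
    rw [this, inner_smul_right]
    positivity

theorem Generic.eventually_smul_add_mem_face (hv : cs.Generic v) (y : ModelSpace n) :
    ∀ᶠ t : ℝ in atTop, t • v + y ∈ cs.face v :=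
  SphericalCoxeterSystem.eventually_smul_add_mem_face fun b hb h => (hv b hb h).elim

namespace IsPanelVector

variable (h : cs.IsPanelVector ξ a)
include h

theorem inner_eq_zero_of_mem (hy : y ∈ cs.face ξ) : ⟪a, y⟫ = 0 :=
  inner_eq_zero_of_mem_face h.mem h.inner_eq_zero hy

theorem eventually_smul_add_mem (hy : ⟪a, y⟫ = 0) : ∀ᶠ t : ℝ in atTop, t • ξ + y ∈ cs.face ξ :=
  eventually_smul_add_mem_face fun b hb hb0 => by
    rcases h.eq_or_eq_neg b hb hb0 with rfl | rfl
    · exact hy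
    · rw [inner_neg_left, hy, neg_zero]

theorem exists_sub_mem (hy : ⟪a, y⟫ = 0) : ∃ p ∈ cs.face ξ, ∃ q ∈ cs.face ξ, y = p - q := by
  obtain ⟨t, ht, ht0⟩ := ((h.eventually_smul_add_mem hy).and (eventually_ge_atTop 0)).exists
  exact ⟨_, ht, t • ξ, smul_mem_face ht0 self_mem_face, by abel⟩

theorem exists_generic : ∃ ε : ℝ, 0 < ε ∧ cs.Generic (ξ + ε • a) ∧ cs.Generic (ξ - ε • a) ∧
    cs.face ξ ⊆ cs.face (ξ + ε • a) ∧ cs.face ξ ⊆ cs.face (ξ - ε • a) := by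
  have key : ∀ b ∈ cs.roots, ⟪b, ξ⟫ = 0 → ⟪b, a⟫ ≠ 0 ∧ ⟪b, -a⟫ ≠ 0 := by
    intro b hb hb0
    have haa := inner_self_of_mem_roots h.mem
    rcases h.eq_or_eq_neg b hb hb0 with rfl | rfl <;>
      simp only [inner_neg_left, inner_neg_right, haa] <;> norm_num
  obtain ⟨ε, ⟨h1, h2⟩, ⟨h3, h4⟩, hε⟩ := ((eventually_generic_add_smul (ξ := ξ) (u := a)
    fun b hb hb0 => (key b hb hb0).1).and ((eventually_generic_add_smul (ξ := ξ) (u := -a)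
    fun b hb hb0 => (key b hb hb0).2).and self_mem_nhdsWithin)).exists
  rw [smul_neg, ← sub_eq_add_neg] at h3 h4
  exact ⟨ε, hε, h1, h3, h2, h4⟩

end IsPanelVector

theorem face_eq_of_panel_subset (hξ : cs.IsPanelVector ξ a) {a' : ModelSpace n}
    (hη : cs.IsPanelVector η a') (hsub : cs.face η ⊆ cs.face ξ) : cs.face η = cs.face ξ := by
  have hηξ : η ∈ cs.face ξ := hsub self_mem_face
  have haa' : a' = a ∨ a' = -a := by
    have h0 := hξ.inner_eq_zero_of_mem hηξ
    rcases hη.eq_or_eq_neg a hξ.mem h0 with rfl | rfl <;> simp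
  refine Subset.antisymm hsub (SphericalCoxeterSystem.face_subset_face fun b hb hbη => ?_)
  by_contra hneg
  have h1 := hηξ (-b) (neg_mem_roots hb) (by rw [inner_neg_left]; linarith)
  rw [inner_neg_left] at h1
  have hb0 : ⟪b, η⟫ = 0 := by linarith
  have hξ0 := hξ.inner_eq_zero
  apply hneg
  rcases hη.eq_or_eq_neg b hb hb0 with rfl | rfl <;> rcases haa' with rfl | rfl <;>
    simp [hξ0, inner_neg_left]

theorem isModelSectorFace_iff {F : Set (ModelSpace n)} :
    cs.IsModelSectorFace x F ↔ ∃ ξ, F = {y | y - x ∈ cs.face ξ} := by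
  constructor
  · rintro ⟨-, σ, hσ, rfl⟩
    have hσ' : ∀ b ∈ cs.roots, σ {y | ⟪b, y⟫ = ⟪b, x⟫} = {y | ⟪b, y⟫ = ⟪b, x⟫} ∨
        σ {y | ⟪b, y⟫ = ⟪b, x⟫} = {y | ⟪b, x⟫ ≤ ⟪b, y⟫} ∨
        σ {y | ⟪b, y⟫ = ⟪b, x⟫} = {y | ⟪b, y⟫ ≤ ⟪b, x⟫} := by
      intro b hb
      rcases hσ _ (isModelWall_iff.mpr ⟨b, hb, _, rfl⟩) rfl with h | h
      · exact Or.inl h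
      · exact Or.inr (isModelHalf_cases h hb rfl)
    have hF : (⋂ M ∈ {M | cs.IsModelWall M ∧ x ∈ M}, σ M) =
        {y | ∀ b ∈ cs.roots, y ∈ σ {z | ⟪b, z⟫ = ⟪b, x⟫}} := by
      ext y
      simp only [mem_iInter, mem_ofPred_eq]
      constructor
      · intro h b hb
        exact h _ ⟨isModelWall_iff.mpr ⟨b, hb, _, rfl⟩, rfl⟩
      · rintro h M ⟨hM, hxM⟩
        obtain ⟨b, hb, c, rfl⟩ := isModelWall_iff.mp hM
        have hc : ⟪b, x⟫ = c := hxM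
        subst hc
        exact h b hb
    rw [hF]
    -- the cone of directions, and a vector in its relative interior
    set K : Set (ModelSpace n) := {k | ∀ b ∈ cs.roots, k + x ∈ σ {z | ⟪b, z⟫ = ⟪b, x⟫}} with hK
    have hKmem : ∀ k, k ∈ K ↔ ∀ b ∈ cs.roots,
        k + x ∈ σ {z | ⟪b, z⟫ = ⟪b, x⟫} := fun k => Iff.rfl
    have hK0 : (0 : ModelSpace n) ∈ K := by
      intro b hb
      rcases hσ' b hb with h | h | h <;> rw [h] <;> simp
    have hKadd : ∀ k ∈ K, ∀ l ∈ K, k + l ∈ K := by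
      intro k hk l hl b hb
      have h1 := hk b hb
      have h2 := hl b hb
      rcases hσ' b hb with h | h | h <;> rw [h] at h1 h2 ⊢ <;>
        simp only [mem_ofPred_eq, inner_add_right] at h1 h2 ⊢ <;> linarith
    have hside : ∀ b ∈ cs.roots, (∃ k ∈ K, 0 < ⟪b, k⟫) → ∀ k ∈ K, 0 ≤ ⟪b, k⟫ := by
      rintro b hb ⟨k, hk, hk0⟩ l hl
      have h1 := hk b hb
      have h2 := hl b hb
      rcases hσ' b hb with h | h | h <;> rw [h] at h1 h2 <;>
        simp only [mem_ofPred_eq, inner_add_right] at h1 h2 ⊢ <;> linarith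
    obtain ⟨ξ, hξK, hξ⟩ : ∃ ξ ∈ K, ∀ b ∈ cs.roots, (∃ k ∈ K, 0 < ⟪b, k⟫) → 0 < ⟪b, ξ⟫ := by
      suffices H : ∀ T : Set (ModelSpace n), T.Finite → T ⊆ cs.roots →
          ∃ ξ ∈ K, ∀ b ∈ T, (∃ k ∈ K, 0 < ⟪b, k⟫) → 0 < ⟪b, ξ⟫ from
        H _ roots_finite Subset.rfl
      intro T hT
      induction T, hT using Set.Finite.induction_on with
      | empty => exact fun _ => ⟨0, hK0, by simp⟩
      | @insert c T _ _ ih =>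
        intro hsub
        obtain ⟨ξ, hξK, hξ⟩ := ih ((subset_insert c T).trans hsub)
        by_cases hc : ∃ k ∈ K, 0 < ⟪c, k⟫
        · obtain ⟨k, hk, hck⟩ := id hc
          refine ⟨ξ + k, hKadd _ hξK _ hk, ?_⟩
          rintro b (rfl | hb) hbk
          · rw [inner_add_right]
            have := hside b (hsub (mem_insert _ _)) hc ξ hξK
            linarith
          · rw [inner_add_right]
            have h1 := hξ b hb hbk
            have h2 := hside b (hsub (mem_insert_of_mem _ hb)) hbk k hk
            linarith
        · refine ⟨ξ, hξK, ?_⟩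
          rintro b (rfl | hb) hbk
          · exact (hc hbk).elim
          · exact hξ b hb hbk
    refine ⟨ξ, ?_⟩
    ext y
    constructor
    · intro hy b hb hbξ
      by_contra hneg
      have := hξ (-b) (neg_mem_roots hb) ⟨y - x, by
        intro c hc; rw [sub_add_cancel]; exact hy c hc, by rw [inner_neg_left]; linarith⟩
      rw [inner_neg_left] at this
      linarith
    · intro hy b hb
      have hy1 := hy b hb
      have hy2 := hy (-b) (neg_mem_roots hb)
      have h1 := hξK b hb
      rcases hσ' b hb with h | h | h <;> rw [h] at h1 ⊢ <;>
        simp only [mem_ofPred_eq, inner_add_right, inner_neg_left, inner_sub_right]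
          at h1 hy1 hy2 ⊢
      · have h2 := hy1 (by linarith)
        have h3 := hy2 (by linarith)
        linarith
      · have h2 := hy1 (by linarith)
        linarith
      · have h3 := hy2 (by linarith)
        linarith
  · rintro ⟨ξ, rfl⟩
    refine ⟨⟨x, by simpa using zero_mem_face⟩, fun M => {y | ∀ b ∈ cs.roots,
      M = {z | ⟪b, z⟫ = ⟪b, x⟫} → 0 ≤ ⟪b, ξ⟫ → ⟪b, x⟫ ≤ ⟪b, y⟫}, ?_, ?_⟩
    · intro M hM hxM
      obtain ⟨a, ha, c, rfl⟩ := isModelWall_iff.mp hM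
      have hc : ⟪a, x⟫ = c := hxM
      subst hc
      have huniq : ∀ b ∈ cs.roots, {z | ⟪a, z⟫ = ⟪a, x⟫} = {z | ⟪b, z⟫ = ⟪b, x⟫} →
          b = a ∨ b = -a := by
        intro b hb h
        refine eq_or_eq_neg_of_orthogonal_subset ha.1 hb.1 fun z hz => ?_
        have h1 : z + x ∈ {z | ⟪a, z⟫ = ⟪a, x⟫} := by
          simp only [mem_ofPred_eq, inner_add_right, hz, zero_add]
        rw [h] at h1
        simpa [inner_add_right] using h1
      have hset : {y | ∀ b ∈ cs.roots, {z | ⟪a, z⟫ = ⟪a, x⟫} = {z | ⟪b, z⟫ = ⟪b, x⟫} →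
          0 ≤ ⟪b, ξ⟫ → ⟪b, x⟫ ≤ ⟪b, y⟫} =
          {y | (0 ≤ ⟪a, ξ⟫ → ⟪a, x⟫ ≤ ⟪a, y⟫) ∧ (⟪a, ξ⟫ ≤ 0 → ⟪a, y⟫ ≤ ⟪a, x⟫)} := by
        ext y
        constructor
        · intro h
          refine ⟨h a ha rfl, fun h0 => ?_⟩
          have := h (-a) (neg_mem_roots ha) (by simp only [inner_neg_left, neg_inj])
          simp only [inner_neg_left] at this
          linarith [this (by linarith)]
        · rintro ⟨h1, h2⟩ b hb hab hb0
          rcases huniq b hb hab with rfl | rfl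
          · exact h1 hb0
          · simp only [inner_neg_left] at hb0 ⊢
            linarith [h2 (by linarith)]
      simp only []
      rw [hset]
      rcases lt_trichotomy ⟪a, ξ⟫ 0 with h | h | h
      · right
        convert isModelHalf_le ha ⟪a, x⟫ using 1
        ext y
        simp [h.le, not_le.mpr h]
      · left
        ext y
        simp only [mem_ofPred_eq, h, le_refl, forall_const]
        exact ⟨fun h => le_antisymm h.2 h.1, fun h => ⟨h.ge, h.le⟩⟩
      · right
        convert isModelHalf_ge ha ⟪a, x⟫ using 1
        ext y
        simp [h.le, not_le.mpr h]
    · ext y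
      simp only [mem_iInter, mem_ofPred_eq]
      constructor
      · rintro h M - b hb - hbξ
        have := h b hb hbξ
        rw [inner_sub_right] at this
        linarith
      · intro h b hb hbξ
        have := h {z | ⟪b, z⟫ = ⟪b, x⟫} ⟨isModelWall_iff.mpr ⟨b, hb, _, rfl⟩, rfl⟩ b hb rfl hbξ
        rw [inner_sub_right]
        linarith

theorem face_subset_of_translate_subset {p : ModelSpace n}
    (h : ∀ y ∈ cs.face η, p + y ∈ cs.face ξ) : cs.face η ⊆ cs.face ξ := by
  intro y hy b hb hbξ
  by_contra hneg
  push Not at hneg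
  obtain ⟨t, ht⟩ := exists_nat_gt (⟪b, p⟫ / -⟪b, y⟫)
  rw [div_lt_iff₀ (by linarith)] at ht
  have := h ((t : ℝ) • y) (smul_mem_face t.cast_nonneg hy) b hb hbξ
  rw [inner_add_right, inner_smul_right] at this
  linarith

theorem setOf_sub_mem_face_subset (h : {y | y - x ∈ cs.face η} ⊆ {y | y - x ∈ cs.face ξ}) :
    cs.face η ⊆ cs.face ξ := fun y hy => by
  have : y + x ∈ {y | y - x ∈ cs.face ξ} := h (by simpa using hy)
  simpa using this

theorem Generic.isModelSector (hv : cs.Generic v) (x : ModelSpace n) :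
    cs.IsModelSector x {y | y - x ∈ cs.face v} := by
  refine ⟨isModelSectorFace_iff.mpr ⟨v, rfl⟩, fun F' hF' hsub => ?_⟩
  obtain ⟨η, rfl⟩ := isModelSectorFace_iff.mp hF'
  refine Subset.antisymm (fun y hy => ?_) hsub
  exact hv.face_subset_face (setOf_sub_mem_face_subset hsub self_mem_face) hy

theorem exists_generic_of_isModelSector {F : Set (ModelSpace n)} (hF : cs.IsModelSector x F) :
    ∃ v, cs.Generic v ∧ F = {y | y - x ∈ cs.face v} := by
  obtain ⟨hF1, hF2⟩ := hF
  obtain ⟨ξ, rfl⟩ := isModelSectorFace_iff.mp hF1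
  obtain ⟨v, hv, hsub⟩ := exists_generic_face_superset (cs := cs) ξ
  exact ⟨v, hv, (hF2 _ (isModelSectorFace_iff.mpr ⟨v, rfl⟩) fun y hy => hsub hy).symm⟩

theorem direction_affineSpan_face (x ξ : ModelSpace n) :
    (affineSpan ℝ {y | y - x ∈ cs.face ξ}).direction = Submodule.span ℝ (cs.face ξ) := by
  rw [direction_affineSpan, vectorSpan_def]
  apply le_antisymm
  · rw [Submodule.span_le]
    rintro _ ⟨y, hy, z, hz, rfl⟩
    have : y -ᵥ z = (y - x) - (z - x) := by rw [vsub_eq_sub]; abel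
    change y -ᵥ z ∈ _
    rw [this]
    exact Submodule.sub_mem _ (Submodule.subset_span hy) (Submodule.subset_span hz)
  · rw [Submodule.span_le]
    intro y hy
    refine Submodule.subset_span ⟨y + x, by simpa using hy, x, by simpa using zero_mem_face, ?_⟩
    simp

theorem exists_panelVector {F : Set (ModelSpace n)} (hF : cs.IsModelSectorPanel x F)
    (hroots : cs.roots.Nonempty) :
    ∃ ξ a, cs.IsPanelVector ξ a ∧ F = {y | y - x ∈ cs.face ξ} := by
  obtain ⟨hF1, hF2⟩ := hF
  obtain ⟨ξ, rfl⟩ := isModelSectorFace_iff.mp hF1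
  rw [direction_affineSpan_face] at hF2
  have hn : Module.finrank ℝ (ModelSpace n) = n := by simp
  have hn0 : n ≠ 0 := by
    rintro rfl
    obtain ⟨a, ha⟩ := hroots
    have := ha.1
    rw [Subsingleton.elim a 0, norm_zero] at this
    exact zero_ne_one this
  obtain ⟨a, ha, ha0⟩ : ∃ a ∈ cs.roots, ⟪a, ξ⟫ = 0 := by
    by_contra hgen
    push Not at hgen
    have htop : Submodule.span ℝ (cs.face ξ) = ⊤ := by
      rw [eq_top_iff]
      intro y _
      obtain ⟨t, ht, ht0⟩ := ((Generic.eventually_smul_add_mem_face (v := ξ) hgen y).and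
        (eventually_ge_atTop 0)).exists
      have : y = (t • ξ + y) - t • ξ := by abel
      rw [this]
      exact Submodule.sub_mem _ (Submodule.subset_span ht)
        (Submodule.subset_span (smul_mem_face ht0 self_mem_face))
    rw [htop, finrank_top, hn] at hF2
    omega
  refine ⟨ξ, a, ⟨ha, ha0, fun b hb hb0 => ?_⟩, rfl⟩
  have hle : Submodule.span ℝ (cs.face ξ) ≤ (Submodule.span ℝ {a})ᗮ := by
    rw [Submodule.span_le]
    intro y hy
    exact Submodule.mem_orthogonal_singleton_iff_inner_right.mpr
      (inner_eq_zero_of_mem_face ha ha0 hy)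
  have : Fact (Module.finrank ℝ (ModelSpace n) = (n - 1) + 1) := ⟨by rw [hn]; omega⟩
  have heq := Submodule.eq_of_le_of_finrank_eq hle (by
    rw [hF2, Submodule.finrank_orthogonal_span_singleton (n := n - 1)]
    rintro rfl
    have := ha.1
    rw [norm_zero] at this
    exact zero_ne_one this)
  refine eq_or_eq_neg_of_orthogonal_subset ha.1 hb.1 fun y hy => ?_
  have hy' : y ∈ Submodule.span ℝ (cs.face ξ) := by
    rw [heq]; exact Submodule.mem_orthogonal_singleton_iff_inner_right.mpr hy
  have hle' : Submodule.span ℝ (cs.face ξ) ≤ (Submodule.span ℝ {b})ᗮ := by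
    rw [Submodule.span_le]
    intro y hy
    exact Submodule.mem_orthogonal_singleton_iff_inner_right.mpr
      (inner_eq_zero_of_mem_face hb hb0 hy)
  exact Submodule.mem_orthogonal_singleton_iff_inner_right.mp (hle' hy')

end SphericalCoxeterSystem

end Faces

section ConeSystems

open scoped RealInnerProductSpace
open Filter Topology

theorem dist_zero_one_le_of_locally {Z : Type*} [PseudoMetricSpace Z] {g : ℝ → Z} {c : ℝ}
    (hg : ∀ t, ∀ᶠ s in 𝓝 t, dist (g t) (g s) ≤ c * |t - s|) : dist (g 0) (g 1) ≤ c := by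
  have hcont : Continuous g := by
    rw [continuous_iff_continuousAt]
    intro t
    rw [ContinuousAt, tendsto_iff_dist_tendsto_zero]
    have hlim : Tendsto (fun s : ℝ => c * |t - s|) (𝓝 t) (𝓝 0) := by
      have : Tendsto (fun s : ℝ => c * |t - s|) (𝓝 t) (𝓝 (c * |t - t|)) :=
        Continuous.tendsto (by fun_prop) t
      simpa using this
    refine squeeze_zero' (Eventually.of_forall fun _ => dist_nonneg) ?_ hlim
    filter_upwards [hg t] with s hs
    rwa [dist_comm]
  have hsub : Icc (0 : ℝ) 1 ⊆ {t | dist (g 0) (g t) ≤ c * t} := by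
    apply IsClosed.Icc_subset_of_forall_exists_gt
    · exact (isClosed_le (by fun_prop) (by fun_prop)).inter isClosed_Icc
    · simp
    · rintro t ⟨ht, -⟩ y hy
      obtain ⟨s, hs, hsy⟩ := (((hg t).filter_mono nhdsWithin_le_nhds).and
        (Ioc_mem_nhdsGT (mem_Ioi.mp hy))).exists
      refine ⟨s, ?_, hsy⟩
      have h1 : dist (g 0) (g t) ≤ c * t := ht
      have h2 := dist_triangle (g 0) (g t) (g s)
      rw [abs_sub_comm, abs_of_pos (sub_pos.mpr hsy.1)] at hs
      change dist (g 0) (g s) ≤ c * s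
      linarith
  have := hsub (right_mem_Icc.mpr zero_le_one)
  rw [mem_ofPred_eq, mul_one] at this
  exact this

namespace SphericalCoxeterSystem

variable {n : ℕ} {cs : SphericalCoxeterSystem n} {ξ v a x y : ModelSpace n}

theorem Generic.exists_sub_mem (hv : cs.Generic v) (y : ModelSpace n) :
    ∃ p ∈ cs.face v, ∃ q ∈ cs.face v, y = p - q := by
  obtain ⟨t, ht, ht0⟩ := ((hv.eventually_smul_add_mem_face y).and (eventually_ge_atTop 0)).exists
  exact ⟨_, ht, t • v, smul_mem_face ht0 self_mem_face, by abel⟩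

theorem Generic.eq_of_dist_eq (hv : cs.Generic v)
    (h : ∀ z ∈ cs.face v, dist x z = dist y z) : x = y := by
  have h0 := h 0 zero_mem_face
  rw [dist_zero_right, dist_zero_right] at h0
  have hz : ∀ z ∈ cs.face v, ⟪x - y, z⟫ = 0 := by
    intro z hz
    have h1 := h z hz
    rw [dist_eq_norm, dist_eq_norm] at h1
    have h2 := norm_sub_sq_real x z
    have h3 := norm_sub_sq_real y z
    rw [h1, h0] at h2
    rw [inner_sub_left]
    linarith
  obtain ⟨p, hp, q, hq, hpq⟩ := hv.exists_sub_mem (x - y)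
  have : ⟪x - y, x - y⟫ = 0 := by
    nth_rewrite 2 [hpq]
    rw [inner_sub_right, hz p hp, hz q hq, sub_zero]
  exact sub_eq_zero.mp (inner_self_eq_zero.mp this)

theorem neg_mem_face_neg (hy : y ∈ cs.face v) :
    -y ∈ cs.face (-v) := by
  intro b hb hbv
  rw [inner_neg_right] at hbv ⊢
  have := hy (-b) (neg_mem_roots hb) (by rw [inner_neg_left]; linarith)
  rw [inner_neg_left] at this
  linarith

/-- A family of isometric embeddings of the model space, all based at the same point, any two
of whose sectors lie in a common one. -/
structure IsConeSystem (cs : SphericalCoxeterSystem n) {Y : Type*} [MetricSpace Y]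
    (𝓕 : Set (ModelSpace n → Y)) : Prop where
  isometry : ∀ f ∈ 𝓕, Isometry f
  comp : ∀ f ∈ 𝓕, ∀ l ∈ cs.linW, f ∘ l ∈ 𝓕
  exchange : ∀ f ∈ 𝓕, ∀ h ∈ 𝓕, ∀ v w, cs.Generic v → cs.Generic w →
    ∃ k ∈ 𝓕, (∀ x ∈ cs.face v, k x = f x) ∧ ∃ l ∈ cs.linW, ∀ y ∈ cs.face w, h y = k (l y)

namespace IsConeSystem

variable {Y : Type*} [MetricSpace Y] {𝓕 : Set (ModelSpace n → Y)} (H : cs.IsConeSystem 𝓕)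
  {f h f₁ f₂ : ModelSpace n → Y}
include H

theorem exists_retraction (hf : f ∈ 𝓕) (hh : h ∈ 𝓕) (hv : cs.Generic v) :
    ∃ T : ModelSpace n → ModelSpace n, (∀ x y, dist (T x) (T y) ≤ dist x y) ∧
      ∀ x, ∀ y ∈ cs.face v, dist (h x) (f y) = dist (T x) y := by
  have key : ∀ w, cs.Generic w → ∃ l ∈ cs.linW, ∀ x ∈ cs.face w, ∀ y ∈ cs.face v,
      dist (h x) (f y) = dist (l x) y := by
    intro w hw
    obtain ⟨k, hk, hkf, l, hl, hkh⟩ := H.exchange f hf h hh v w hv hw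
    refine ⟨l, hl, fun x hx y hy => ?_⟩
    rw [hkh x hx, ← hkf y hy, (H.isometry k hk).dist_eq]
  choose! l hl hlx using key
  choose w hw hxw using cs.exists_generic_mem_face
  have hT : ∀ x, ∀ y ∈ cs.face v, dist (h x) (f y) = dist (l (w x) x) y :=
    fun x y hy => hlx (w x) (hw x) x (hxw x) y hy
  have hTw : ∀ u, cs.Generic u → ∀ x ∈ cs.face u, l (w x) x = l u x := fun u hu x hx =>
    hv.eq_of_dist_eq fun z hz => by rw [← hT x z hz, hlx u hu x hx z hz]
  refine ⟨fun x => l (w x) x, fun x y => ?_, hT⟩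
  have hloc : ∀ x, ∀ᶠ y in 𝓝 x, dist (l (w x) x) (l (w y) y) = dist x y := by
    intro x
    filter_upwards [cs.eventually_mem_face x] with y hy
    obtain ⟨u, hu, hyu⟩ := cs.exists_generic_face_superset y
    rw [hTw u hu x (hyu hy), hTw u hu y (hyu self_mem_face), LinearIsometryEquiv.dist_map]
  have := dist_zero_one_le_of_locally (c := dist x y)
    (g := fun t : ℝ => l (w (AffineMap.lineMap x y t)) (AffineMap.lineMap x y t)) (by
      intro t
      have hc : Tendsto (fun s : ℝ => AffineMap.lineMap x y s) (𝓝 t)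
          (𝓝 (AffineMap.lineMap x y t : ModelSpace n)) :=
        Continuous.tendsto AffineMap.lineMap_continuous t
      filter_upwards [hc.eventually (hloc _)] with s hs
      rw [hs, dist_lineMap_lineMap, Real.dist_eq, mul_comm])
  simpa using this

theorem convex_eq (hf : f ∈ 𝓕) (hh : h ∈ 𝓕) : Convex ℝ {x | f x = h x} := by
  rw [convex_iff_segment_subset]
  intro u hu y hy z hz
  obtain ⟨w, hw, hzw⟩ := cs.exists_generic_mem_face z
  obtain ⟨T, hT1, hT2⟩ := H.exists_retraction hf hh hw
  have hfix : ∀ x, f x = h x → T x = x := fun x hx => hw.eq_of_dist_eq fun c hc => by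
    rw [← hT2 x c hc, ← hx, (H.isometry f hf).dist_eq]
  rw [segment_eq_image_lineMap] at hz
  obtain ⟨t, ⟨ht0, ht1⟩, rfl⟩ := hz
  have h1 := hT1 u (AffineMap.lineMap u y t)
  have h2 := hT1 (AffineMap.lineMap u y t) y
  rw [hfix u hu, dist_left_lineMap, Real.norm_of_nonneg ht0] at h1
  rw [hfix y hy, dist_lineMap_right, Real.norm_of_nonneg (by linarith)] at h2
  have h3 := dist_triangle u (T (AffineMap.lineMap u y t)) y
  have hTz := eq_lineMap_of_dist_eq_mul_of_dist_eq_mul (x := u) (z := y)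
    (y := T (AffineMap.lineMap u y t)) (r := t) (by linarith) (by linarith)
  have := hT2 (AffineMap.lineMap u y t) _ hzw
  rw [hTz, dist_self] at this
  exact (dist_eq_zero.mp this).symm

theorem eq_on_face_of_eventually (hf : f ∈ 𝓕) (hh : h ∈ 𝓕) (hv : cs.Generic v)
    (he : ∀ᶠ y in 𝓝 v, f y = h y) : ∀ y ∈ cs.face v, f y = h y := by
  obtain ⟨k, hk, hkf, l, hl, hkh⟩ := H.exchange f hf h hh v v hv hv
  have hl1 : ∀ᶠ y in 𝓝 v, l y = y := by
    filter_upwards [he, hv.eventually_mem_face] with y hy hyv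
    apply (H.isometry k hk).injective
    rw [← hkh y hyv, ← hy, hkf y hyv]
  have hl2 : ∀ y, l y = y := by
    intro y
    obtain ⟨t, ⟨ht, ht1⟩⟩ := (((tendsto_add_smul v y).eventually hl1).and
      self_mem_nhdsWithin).exists
    rw [map_add, map_smul, hl1.self_of_nhds, add_right_inj] at ht
    exact smul_right_injective _ (ne_of_gt ht1) ht
  intro y hy
  rw [hkh y hy, hl2, hkf y hy]

theorem map_neg_eq_of_eq {k : ModelSpace n → Y} (hh : h ∈ 𝓕) (hk : k ∈ 𝓕)
    (l : ModelSpace n ≃ₗᵢ[ℝ] ModelSpace n) (h1 : h x = k x) (h2 : h (-x) = k (l (-x))) :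
    l (-x) = -x := by
  have hd : dist (l (-x)) x = dist (-x) x := by
    rw [← (H.isometry k hk).dist_eq, ← h1, ← h2, (H.isometry h hh).dist_eq]
  rw [dist_eq_norm, dist_eq_norm] at hd
  have e1 := norm_sub_sq_real (l (-x)) x
  have e2 := norm_sub_sq_real (-x) x
  have e3 := norm_add_sq_real (l (-x)) x
  rw [hd, e2] at e1
  rw [l.norm_map, norm_neg] at e1 e3
  rw [inner_neg_left, real_inner_self_eq_norm_sq] at e1
  have : ‖l (-x) + x‖ ^ 2 = 0 := by rw [e3]; linarith
  rw [sq_eq_zero_iff, norm_eq_zero] at this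
  exact eq_neg_of_add_eq_zero_left this

theorem exists_join (hf : f ∈ 𝓕) (hf₁ : f₁ ∈ 𝓕) (hf₂ : f₂ ∈ 𝓕) (hp : cs.IsPanelVector ξ a)
    {ε : ℝ} (hv : cs.Generic (ξ + ε • a)) (hv' : cs.Generic (ξ - ε • a))
    (hsub : cs.face ξ ⊆ cs.face (ξ + ε • a)) (hsub' : cs.face ξ ⊆ cs.face (ξ - ε • a))
    {ρ : ModelSpace n ≃ₗᵢ[ℝ] ModelSpace n} (hρ : ρ ∈ cs.linW)
    (hρx : ∀ x, ρ x = x - (2 * ⟪a, x⟫) • a)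
    (e₁ : ∀ x ∈ cs.face ξ, f₁ x = f x) (e₂ : ∀ x ∈ cs.face ξ, f₂ x = f x)
    (hne : ¬ ∀ x ∈ cs.face (ξ + ε • a), f x = f₂ (ρ x)) :
    ∃ h ∈ 𝓕, (∀ x ∈ cs.face (ξ + ε • a), h x = f x) ∧
      (∀ x ∈ cs.face (ξ - ε • a), h x = f₂ x) ∧ ∀ x ∈ cs.face ξ, h (-x) = f₁ (-x) := by
  obtain ⟨k, hk, hkf, l, hl, hkl⟩ := H.exchange f hf f₁ hf₁ _ _ hv hv.neg
  have hk₁ : ∀ x ∈ cs.face ξ, k (-x) = f₁ (-x) := by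
    intro x hx
    have h2 := hkl (-x) (neg_mem_face_neg (hsub hx))
    have h1 : f₁ x = k x := by rw [hkf x (hsub hx), e₁ x hx]
    rw [h2, H.map_neg_eq_of_eq hf₁ hk l h1 h2]
  obtain ⟨h0, hh0, hh0f, L, hL, hkL⟩ := H.exchange f₂ hf₂ k hk _ _ hv' hv'.neg
  have hk0 : ∀ x ∈ cs.face ξ, k x = h0 x := fun x hx => by
    rw [hkf x (hsub hx), hh0f x (hsub' hx), e₂ x hx]
  have hL1 : ∀ x ∈ cs.face ξ, L x = x := by
    intro x hx
    have h2 := hkL (-x) (neg_mem_face_neg (hsub' hx))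
    have := H.map_neg_eq_of_eq hk hh0 L (hk0 x hx) h2
    rwa [map_neg, neg_inj] at this
  have hLa : ∀ x, ⟪a, x⟫ = 0 → L x = x := by
    intro x hx
    obtain ⟨p, hp, q, hq, rfl⟩ := hp.exists_sub_mem hx
    rw [map_sub, hL1 p hp, hL1 q hq]
  have near : ∀ h ∈ 𝓕, (∀ x ∈ cs.face ξ, k x = h x) →
      (∀ y ∈ cs.face (-(ξ - ε • a)), k y = h y) → ∀ᶠ y in 𝓝 (ξ + ε • a), f y = h y := by
    intro h hh h1 h2
    have ht : Tendsto (fun y : ModelSpace n => y - (2 : ℝ) • ξ) (𝓝 (ξ + ε • a))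
        (𝓝 (-(ξ - ε • a))) := by
      have : -(ξ - ε • a) = (ξ + ε • a) - (2 : ℝ) • ξ := by module
      rw [this]
      exact Continuous.tendsto (by fun_prop) _
    filter_upwards [ht.eventually hv'.neg.eventually_mem_face, hv.eventually_mem_face]
      with y hy1 hy2
    rw [← hkf y hy2]
    have hc := H.convex_eq hk hh
      (show (4 : ℝ) • ξ ∈ _ from h1 _ (smul_mem_face (by norm_num) self_mem_face))
      (show (2 : ℝ) • (y - (2 : ℝ) • ξ) ∈ _ from h2 _ (smul_mem_face (by norm_num) hy1))
      (a := 1 / 2) (b := 1 / 2) (by norm_num) (by norm_num) (by norm_num)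
    have : (1 / 2 : ℝ) • (4 : ℝ) • ξ + (1 / 2 : ℝ) • (2 : ℝ) • (y - (2 : ℝ) • ξ) = y := by module
    rwa [this] at hc
  rcases eq_id_or_reflection_of_fix_hyperplane hp.mem.1 L.toLinearIsometry hLa with hid | href
  · have hid : ∀ x, L x = x := hid
    have hh : ∀ y ∈ cs.face (-(ξ - ε • a)), k y = h0 y := fun y hy => by rw [hkL y hy, hid]
    refine ⟨h0, hh0, fun x hx =>
      (H.eq_on_face_of_eventually hf hh0 hv (near h0 hh0 hk0 hh) x hx).symm, hh0f, fun x hx => ?_⟩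
    rw [← hk₁ x hx, hh _ (neg_mem_face_neg (hsub' hx))]
  · have href : ∀ x, L x = x - (2 * ⟪a, x⟫) • a := href
    exfalso
    apply hne
    have hρL : ∀ x, ρ x = L x := fun x => by rw [hρx, href]
    have hρv : ρ (ξ + ε • a) = ξ - ε • a := by
      rw [hρx, inner_add_right, hp.inner_eq_zero, inner_smul_right,
        inner_self_of_mem_roots hp.mem]
      module
    have h1 : ∀ᶠ y in 𝓝 (ξ + ε • a), f y = (h0 ∘ ρ) y :=
      near _ (H.comp h0 hh0 ρ hρ)
        (fun x hx => by rw [Function.comp_apply, hρL, hL1 x hx, hk0 x hx])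
        (fun y hy => by rw [Function.comp_apply, hρL, hkL y hy])
    refine H.eq_on_face_of_eventually hf (H.comp f₂ hf₂ ρ hρ) hv ?_
    filter_upwards [h1, hv.eventually_mem_face] with y hy1 hy2
    rw [hy1]
    refine hh0f _ ?_
    rw [← hρv]
    exact map_mem_face hρ hy2

end IsConeSystem

end SphericalCoxeterSystem

end ConeSystems

section ConeAtInfinity

open scoped RealInnerProductSpace
open Filter Topology SphericalCoxeterSystem

namespace SphericalCoxeterSystem

variable {n : ℕ} {cs : SphericalCoxeterSystem n} {v : ModelSpace n}

theorem finite_range_face : (range cs.face).Finite := by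
  refine ((roots_finite (cs := cs)).finite_subsets.image
    fun T => {y | ∀ b ∈ T, 0 ≤ ⟪b, y⟫}).subset ?_
  rintro _ ⟨ξ, rfl⟩
  refine ⟨{b | b ∈ cs.roots ∧ 0 ≤ ⟪b, ξ⟫}, fun b hb => hb.1, ?_⟩
  ext y
  exact ⟨fun h b hb hbξ => h b ⟨hb, hbξ⟩, fun h b hb => h b hb.1 hb.2⟩

theorem Generic.eq_id_of_eq_on_face (hv : cs.Generic v) {l : ModelSpace n ≃ₗᵢ[ℝ] ModelSpace n}
    (h : ∀ x ∈ cs.face v, l x = x) (x : ModelSpace n) : l x = x := by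
  obtain ⟨p, hp, q, hq, rfl⟩ := hv.exists_sub_mem x
  rw [map_sub, h p hp, h q hq]

end SphericalCoxeterSystem

namespace RBuilding

variable {n : ℕ} {cs : SphericalCoxeterSystem n} {X : Type*} [MetricSpace X] {Λ : Set X}
  (B : RBuilding cs X Λ) {v w x y ξ η : ModelSpace n} {l : ModelSpace n ≃ₗᵢ[ℝ] ModelSpace n}

theorem dist_chart (f : B.charts) (x y : ModelSpace n) : dist (f.1 x) (f.1 y) = dist x y :=
  (B.isom f f.2).dist_eq x y

theorem chart_injective (f : B.charts) : Function.Injective f.1 := (B.isom f f.2).injective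

/-- The chart `f` precomposed with the affine map `x ↦ l x + u`. -/
def chartComp (f : B.charts) (hl : l ∈ cs.linW) (u : ModelSpace n) : B.charts :=
  ⟨fun x => f.1 (l x + u), B.A1 f f.2 _ (affine_mem_W hl u)⟩

theorem chartComp_apply (f : B.charts) (hl : l ∈ cs.linW) (u x : ModelSpace n) :
    (B.chartComp f hl u).1 x = f.1 (l x + u) := rfl

theorem exists_transition (f g : B.charts) :
    ∃ l ∈ cs.linW, ∃ u, ∀ x, f.1 x ∈ range g.1 → f.1 x = g.1 (l x + u) := by
  obtain ⟨-, -, w, hw, h⟩ := B.A2 f f.2 g g.2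
  obtain ⟨l, hl, u, hu⟩ := exists_affine_of_mem_W hw
  exact ⟨l, hl, u, fun x hx => by rw [h x hx, hu]⟩

theorem exists_of_image_face_subset (f g : B.charts)
    (hsub : g.1 '' {z | z - y ∈ cs.face η} ⊆ f.1 '' {z | z - x ∈ cs.face ξ}) :
    ∃ l ∈ cs.linW, ∃ p, p ∈ cs.face ξ ∧ (∀ z ∈ cs.face η, g.1 (y + z) = f.1 (x + p + l z)) ∧
      cs.face (l η) ⊆ cs.face ξ := by
  obtain ⟨l, hl, u, hlu⟩ := B.exists_transition g f
  have key : ∀ z ∈ cs.face η, g.1 (y + z) = f.1 (x + (l y + u - x) + l z) ∧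
      (l y + u - x) + l z ∈ cs.face ξ := by
    intro z hz
    obtain ⟨c, hc, hcz⟩ := hsub ⟨y + z, by simpa using hz, rfl⟩
    have h1 := hlu (y + z) ⟨c, hcz⟩
    have h2 : x + (l y + u - x) + l z = l (y + z) + u := by rw [map_add]; abel
    refine ⟨by rw [h1, h2], ?_⟩
    have h3 : c = l (y + z) + u := B.chart_injective f (hcz.trans h1)
    have h4 : l y + u - x + l z = c - x := by rw [h3, ← h2]; abel
    rw [h4]
    exact hc
  refine ⟨l, hl, l y + u - x, ?_, fun z hz => (key z hz).1,
    face_subset_of_translate_subset (p := l y + u - x) fun z hz => ?_⟩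
  · simpa using (key 0 zero_mem_face).2
  · have := (key (l.symm z) ((map_mem_face_iff hl).mp (by simpa using hz))).2
    simpa using this

theorem exists_common_chart (f h : B.charts) (hv : cs.Generic v) (hw : cs.Generic w) :
    ∃ k : B.charts, ∃ p q τ, ∃ l ∈ cs.linW, (∀ x ∈ cs.face v, f.1 (p + x) = k.1 (p + x)) ∧
      ∀ y ∈ cs.face w, h.1 (q + y) = k.1 (τ + l y) := by
  have hsec : ∀ (f : B.charts) {v}, cs.Generic v →
      IsSector cs B.charts (f.1 '' {y | y - 0 ∈ cs.face v}) := fun f v hv =>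
    ⟨_, f, f.2, 0, _, hv.isModelSector 0, rfl, rfl⟩
  obtain ⟨T₁, T₂, g, hg, hT₁, hT₂, hs₁, hs₂, hr₁, hr₂⟩ := B.A4 _ _ (hsec f hv) (hsec h hw)
  have key : ∀ (f : B.charts) {v} {T : Set X}, IsSector cs B.charts T →
      T ⊆ f.1 '' {y | y - 0 ∈ cs.face v} → T ⊆ range g → ∃ p, ∃ m ∈ cs.linW, ∃ u,
        ∀ x ∈ cs.face v, f.1 (p + x) = g (m (p + x) + u) := by
    rintro f v _ ⟨_, f', hf', x, s, hs, -, rfl⟩ hsub hran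
    obtain ⟨η, hη, rfl⟩ := exists_generic_of_isModelSector hs
    obtain ⟨l, hl, p, -, hp, hface⟩ := B.exists_of_image_face_subset f ⟨f', hf'⟩ hsub
    obtain ⟨m, hm, u, hmu⟩ := B.exists_transition f ⟨g, hg⟩
    refine ⟨0 + p, m, hm, u, fun x hx => hmu _ ?_⟩
    have hx' : l.symm x ∈ cs.face η := (map_mem_face_iff hl).mp (by
      simpa using (hη.map hl).face_subset_face (hface self_mem_face) hx)
    have := hp _ hx'
    rw [l.apply_symm_apply] at this
    rw [← this]
    exact hran ⟨_, by simpa using hx', rfl⟩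
  obtain ⟨p, m, hm, u, h1⟩ := key f hT₁ hs₁ hr₁
  obtain ⟨q, m', hm', u', h2⟩ := key h hT₂ hs₂ hr₂
  refine ⟨B.chartComp ⟨g, hg⟩ hm u, p, q, m.symm (m' q + u' - u), m'.trans m.symm,
    trans_mem_linW hm' (symm_mem_linW hm), h1, fun y hy => ?_⟩
  rw [h2 y hy, chartComp_apply]
  congr 1
  rw [LinearIsometryEquiv.trans_apply, ← map_add, m.apply_symm_apply, map_add]
  abel

theorem dist_le_of_translate_eq {f k : B.charts} {p τ : ModelSpace n}
    (h : f.1 (p + x) = k.1 (τ + y)) : dist (f.1 x) (k.1 y) ≤ ‖p‖ + ‖τ‖ := by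
  have := dist_triangle (f.1 x) (f.1 (p + x)) (k.1 y)
  rwa [B.dist_chart, dist_add_self_right, h, B.dist_chart, dist_add_self_left] at this

theorem exists_coarse_chart (f h : B.charts) (hv : cs.Generic v) (hw : cs.Generic w) :
    ∃ k : B.charts, ∃ l ∈ cs.linW, ∃ C, (∀ x ∈ cs.face v, dist (f.1 x) (k.1 x) ≤ C) ∧
      ∀ y ∈ cs.face w, dist (h.1 y) (k.1 (l y)) ≤ C := by
  obtain ⟨k, p, q, τ, l, hl, h1, h2⟩ := B.exists_common_chart f h hv hw
  exact ⟨k, l, hl, max (‖p‖ + ‖p‖) (‖q‖ + ‖τ‖),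
    fun x hx => le_max_of_le_left (B.dist_le_of_translate_eq (h1 x hx)),
    fun y hy => le_max_of_le_right (B.dist_le_of_translate_eq (h2 y hy))⟩

/-- A point of the cone at infinity, represented by a ray in a chart. -/
def Ray : Type _ := B.charts × ModelSpace n

/-- The distance at infinity between two rays. -/
def rayDist (r s : B.Ray) : ℝ :=
  limUnder atTop fun t : ℝ => dist (r.1.1 (t • r.2)) (s.1.1 (t • s.2)) / t

theorem tendsto_div_of_abs_sub_le {u : ℝ → ℝ} {C d : ℝ} (h : ∀ t, 0 ≤ t → |u t - t * d| ≤ C) :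
    Tendsto (fun t => u t / t) atTop (𝓝 d) := by
  rw [tendsto_iff_dist_tendsto_zero]
  refine squeeze_zero' (Eventually.of_forall fun _ => dist_nonneg) ?_
    (tendsto_const_nhds (x := C).div_atTop tendsto_id)
  filter_upwards [eventually_gt_atTop 0] with t ht
  rw [Real.dist_eq, id, le_div_iff₀ ht, ← abs_of_pos ht, ← abs_mul, abs_of_pos ht, sub_mul,
    div_mul_cancel₀ _ ht.ne', mul_comm d]
  exact h t ht.le

theorem tendsto_rayDist (r s : B.Ray) :
    Tendsto (fun t : ℝ => dist (r.1.1 (t • r.2)) (s.1.1 (t • s.2)) / t) atTop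
      (𝓝 (B.rayDist r s)) := by
  apply tendsto_nhds_limUnder
  obtain ⟨v, hv, hrv⟩ := cs.exists_generic_mem_face r.2
  obtain ⟨w, hw, hsw⟩ := cs.exists_generic_mem_face s.2
  obtain ⟨k, l, hl, C, h1, h2⟩ := B.exists_coarse_chart r.1 s.1 hv hw
  refine ⟨dist r.2 (l s.2), tendsto_div_of_abs_sub_le (C := 2 * C) fun t ht => ?_⟩
  have e1 := h1 _ (smul_mem_face ht hrv)
  have e2 := h2 _ (smul_mem_face ht hsw)
  have e3 : dist (k.1 (t • r.2)) (k.1 (l (t • s.2))) = t * dist r.2 (l s.2) := by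
    rw [B.dist_chart, map_smul, dist_smul₀, Real.norm_of_nonneg ht]
  have e4 := dist_dist_dist_le (r.1.1 (t • r.2)) (s.1.1 (t • s.2))
    (k.1 (t • r.2)) (k.1 (l (t • s.2)))
  rw [e3, Real.dist_eq] at e4
  linarith

instance : PseudoMetricSpace B.Ray where
  dist := B.rayDist
  dist_self r := tendsto_nhds_unique (B.tendsto_rayDist r r) (by simp)
  dist_comm r s := tendsto_nhds_unique (B.tendsto_rayDist r s)
    (by simpa only [dist_comm] using B.tendsto_rayDist s r)
  dist_triangle r s u := by
    refine le_of_tendsto_of_tendsto (B.tendsto_rayDist r u)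
      ((B.tendsto_rayDist r s).add (B.tendsto_rayDist s u)) ?_
    filter_upwards [eventually_gt_atTop 0] with t ht
    rw [← add_div]
    gcongr
    exact dist_triangle _ _ _

/-- The map from the model space to the cone at infinity induced by a chart. -/
def cone (f : B.charts) (x : ModelSpace n) : SeparationQuotient B.Ray :=
  SeparationQuotient.mk (f, x)

theorem tendsto_dist_cone (f h : B.charts) (x y : ModelSpace n) :
    Tendsto (fun t : ℝ => dist (f.1 (t • x)) (h.1 (t • y)) / t) atTop
      (𝓝 (dist (B.cone f x) (B.cone h y))) :=
  B.tendsto_rayDist (f, x) (h, y)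

theorem dist_cone_eq (f h : B.charts) {C d : ℝ}
    (hC : ∀ t : ℝ, 0 ≤ t → |dist (f.1 (t • x)) (h.1 (t • y)) - t * d| ≤ C) :
    dist (B.cone f x) (B.cone h y) = d :=
  tendsto_nhds_unique (B.tendsto_dist_cone f h x y) (tendsto_div_of_abs_sub_le hC)

theorem cone_eq_of_dist_le (f h : B.charts) {C : ℝ}
    (hC : ∀ t : ℝ, 0 ≤ t → dist (f.1 (t • x)) (h.1 (t • y)) ≤ C) : B.cone f x = B.cone h y :=
  dist_eq_zero.mp (B.dist_cone_eq f h fun t ht => by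
    rw [mul_zero, sub_zero, abs_of_nonneg dist_nonneg]; exact hC t ht)

theorem isometry_cone (f : B.charts) : Isometry (B.cone f) :=
  Isometry.of_dist_eq fun x y => B.dist_cone_eq f f (C := 0) fun t ht => by
    rw [B.dist_chart, dist_smul₀, Real.norm_of_nonneg ht, sub_self, abs_zero]

theorem cone_chartComp (f : B.charts) (hl : l ∈ cs.linW) (u x : ModelSpace n) :
    B.cone (B.chartComp f hl u) x = B.cone f (l x) :=
  B.cone_eq_of_dist_le _ _ (C := ‖u‖) fun t _ => by
    rw [chartComp_apply, B.dist_chart, map_smul, dist_self_add_left]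

theorem isConeSystem_range_cone : cs.IsConeSystem (range B.cone) where
  isometry := by rintro _ ⟨f, rfl⟩; exact B.isometry_cone f
  comp := by
    rintro _ ⟨f, rfl⟩ l hl
    exact ⟨B.chartComp f hl 0, funext fun x => B.cone_chartComp f hl 0 x⟩
  exchange := by
    rintro _ ⟨f, rfl⟩ _ ⟨h, rfl⟩ v w hv hw
    obtain ⟨k, l, hl, C, h1, h2⟩ := B.exists_coarse_chart f h hv hw
    refine ⟨_, ⟨k, rfl⟩, fun x hx => ?_, l, hl, fun y hy => ?_⟩
    · exact (B.cone_eq_of_dist_le _ _ fun t ht => h1 _ (smul_mem_face ht hx)).symm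
    · exact B.cone_eq_of_dist_le _ _ (C := C) fun t ht => by
        simpa only [map_smul] using h2 _ (smul_mem_face ht hy)

theorem exists_dist_le_of_cone_eq (f h : B.charts) {Z : Set (ModelSpace n)}
    (hZ : ∀ x ∈ Z, B.cone f x = B.cone h x) : ∃ C, ∀ x ∈ Z, dist (f.1 x) (h.1 x) ≤ C := by
  have key : ∀ v, cs.Generic v → ∃ C, ∀ x ∈ cs.face v, x ∈ Z → dist (f.1 x) (h.1 x) ≤ C := by
    intro v hv
    obtain ⟨k, l, hl, C, h1, h2⟩ := B.exists_coarse_chart f h hv hv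
    refine ⟨2 * C, fun x hx hxZ => ?_⟩
    have e1 : B.cone f x = B.cone k x :=
      B.cone_eq_of_dist_le _ _ fun t ht => h1 _ (smul_mem_face ht hx)
    have e2 : B.cone h x = B.cone k (l x) := B.cone_eq_of_dist_le _ _ (C := C) fun t ht => by
      simpa only [map_smul] using h2 _ (smul_mem_face ht hx)
    have e3 : l x = x := (B.isometry_cone k).injective (by rw [← e1, ← e2, hZ x hxZ])
    have e4 := h2 x hx
    rw [e3] at e4
    linarith [h1 x hx, dist_triangle_right (f.1 x) (h.1 x) (k.1 x)]
  have key' : ∀ S ∈ range cs.face, ∃ C, ∀ v, cs.Generic v → cs.face v = S →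
      ∀ x ∈ cs.face v, x ∈ Z → dist (f.1 x) (h.1 x) ≤ C := by
    rintro S -
    by_cases hS : ∃ v, cs.Generic v ∧ cs.face v = S
    · obtain ⟨v, hv, rfl⟩ := hS
      obtain ⟨C, hC⟩ := key v hv
      exact ⟨C, fun w _ hwv x hx => hC x (hwv ▸ hx)⟩
    · exact ⟨0, fun w hw hwS => (hS ⟨w, hw, hwS⟩).elim⟩
  choose! C hC using key'
  obtain ⟨D, hD⟩ := ((finite_range_face (cs := cs)).image C).bddAbove
  refine ⟨D, fun x hx => ?_⟩
  obtain ⟨v, hv, hxv⟩ := cs.exists_generic_mem_face x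
  exact (hC _ (mem_range_self v) v hv rfl x hxv hx).trans
    (hD ⟨_, mem_range_self v, rfl⟩)

theorem exists_translate_of_cone_eq (f h : B.charts) (hv : cs.Generic v)
    (he : ∀ x ∈ cs.face v, B.cone f x = B.cone h x) :
    ∃ p τ, (∀ x ∈ cs.face v, f.1 (p + x) ∈ range h.1) ∧
      ∀ x, f.1 x ∈ range h.1 → f.1 x = h.1 (x + τ) := by
  obtain ⟨k, p, q, τ, l, hl, h1, h2⟩ := B.exists_common_chart f h hv hv
  have hl1 : ∀ x ∈ cs.face v, l x = x := by
    intro x hx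
    have e1 : B.cone f x = B.cone k x := B.cone_eq_of_dist_le _ _ fun t ht =>
      B.dist_le_of_translate_eq (h1 _ (smul_mem_face ht hx))
    have e2 : B.cone h x = B.cone k (l x) := B.cone_eq_of_dist_le _ _ fun t ht =>
      B.dist_le_of_translate_eq (by rw [h2 _ (smul_mem_face ht hx), map_smul])
    exact (B.isometry_cone k).injective (by rw [← e1, ← e2, he x hx])
  obtain ⟨N, hN, hN0⟩ := ((hv.eventually_smul_add_mem_face (p - τ)).and
    (eventually_ge_atTop 0)).exists
  have key : ∀ x ∈ cs.face v,
      f.1 (p + N • v + x) = h.1 (q - τ + (p + N • v + x)) := by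
    intro x hx
    have e1 := h1 (N • v + x) (add_mem_face (smul_mem_face hN0 self_mem_face) hx)
    have hy := add_mem_face hN hx
    have e2 := h2 _ hy
    rw [hl1 _ hy] at e2
    have e3 : p + N • v + x = p + (N • v + x) := by abel
    have e4 : q - τ + (p + N • v + x) = q + (N • v + (p - τ) + x) := by abel
    have e5 : τ + (N • v + (p - τ) + x) = p + (N • v + x) := by abel
    rw [e4, e2, e3, e1, e5]
  obtain ⟨m, hm, u, hmu⟩ := B.exists_transition f h
  have hm1 : ∀ x ∈ cs.face v, m (p + N • v + x) + u = q - τ + (p + N • v + x) := fun x hx =>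
    B.chart_injective h ((hmu _ ⟨_, (key x hx).symm⟩).symm.trans (key x hx))
  have hm0 := hm1 0 zero_mem_face
  rw [add_zero] at hm0
  have hmid := hv.eq_id_of_eq_on_face (l := m) fun x hx => by
    have := hm1 x hx
    rw [map_add, add_right_comm, hm0, ← add_assoc _ _ x] at this
    exact add_left_cancel this
  exact ⟨p + N • v, u, fun x hx => ⟨_, (key x hx).symm⟩, fun x hx => by rw [hmu x hx, hmid]⟩

theorem add_mem_of_recession {E : Type*} [NormedAddCommGroup E] [NormedSpace ℝ E] {K : Set E}
    (hK : IsClosed K) (hconv : Convex ℝ K) {p x y : E} (hx : x ∈ K)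
    (hp : ∀ t : ℝ, 0 ≤ t → p + t • y ∈ K) : x + y ∈ K := by
  have hlim : Tendsto (fun t : ℝ => x + t⁻¹ • (p + t • y - x)) atTop (𝓝 (x + y)) := by
    have h1 : Tendsto (fun t : ℝ => x + (t⁻¹ • (p - x) + y)) atTop
        (𝓝 (x + ((0 : ℝ) • (p - x) + y))) :=
      ((tendsto_inv_atTop_zero.smul_const _).add_const _).const_add _
    rw [zero_smul, zero_add] at h1
    refine h1.congr' ?_
    filter_upwards [eventually_gt_atTop 0] with t ht
    rw [add_sub_right_comm, smul_add, inv_smul_smul₀ ht.ne']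
  refine hK.mem_of_tendsto hlim ?_
  filter_upwards [eventually_ge_atTop 1] with t ht
  exact hconv.add_smul_sub_mem hx (hp t (by linarith))
    ⟨by positivity, inv_le_one_of_one_le₀ ht⟩

theorem add_mem_of_recession_halfspace {K : Set (ModelSpace n)} (hK : IsClosed K)
    (hconv : Convex ℝ K) {a : ModelSpace n} (ha : a ∈ cs.roots)
    (h : ∀ v, cs.Generic v → 0 ≤ ⟪a, v⟫ → ∃ p, ∀ x ∈ cs.face v, p + x ∈ K) (hx : x ∈ K)
    (hy : 0 ≤ ⟪a, y⟫) : x + y ∈ K := by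
  have key : ∀ z, 0 < ⟪a, z⟫ → x + z ∈ K := by
    intro z hz
    obtain ⟨v, hv, hzv⟩ := cs.exists_generic_mem_face z
    obtain ⟨p, hp⟩ := h v hv (by
      by_contra hneg
      have := hzv (-a) (neg_mem_roots ha) (by rw [inner_neg_left]; linarith)
      rw [inner_neg_left] at this
      linarith)
    exact add_mem_of_recession hK hconv hx fun t ht => hp _ (smul_mem_face ht hzv)
  refine hK.mem_of_tendsto ((tendsto_add_smul y a).const_add x) ?_
  filter_upwards [self_mem_nhdsWithin] with ε hε
  refine key _ ?_
  rw [inner_add_right, inner_smul_right, inner_self_of_mem_roots ha]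
  have : (0 : ℝ) < ε := hε
  linarith

theorem setOf_mem_range_eq_of_cone_eq (f h : B.charts) {a : ModelSpace n} (ha : a ∈ cs.roots)
    (he : ∀ x, 0 ≤ ⟪a, x⟫ → B.cone f x = B.cone h x) :
    {x | f.1 x ∈ range h.1} = univ ∨ ∃ c, {x | f.1 x ∈ range h.1} = {x | c ≤ ⟪a, x⟫} := by
  obtain ⟨hclosed, hconv, -⟩ := B.A2 f f.2 h h.2
  set K := {x | f.1 x ∈ range h.1} with hK
  have hsec : ∀ v, cs.Generic v → 0 ≤ ⟪a, v⟫ → ∃ p, ∀ x ∈ cs.face v, p + x ∈ K := by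
    intro v hv hav
    obtain ⟨p, _, hp, -⟩ := B.exists_translate_of_cone_eq f h hv fun x hx => he x (hx a ha hav)
    exact ⟨p, hp⟩
  have hadd : ∀ x ∈ K, ∀ y, ⟪a, x⟫ ≤ ⟪a, y⟫ → y ∈ K := fun x hx y hxy => by
    have := add_mem_of_recession_halfspace hclosed hconv ha hsec hx (y := y - x)
      (by rw [inner_sub_right]; linarith)
    rwa [add_sub_cancel] at this
  have hne : ((fun x => ⟪a, x⟫) '' K).Nonempty := by
    obtain ⟨v, hv, hav⟩ := cs.exists_generic_mem_face a
    obtain ⟨p, hp⟩ := hsec v hv (by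
      by_contra hneg
      have := hav (-a) (neg_mem_roots ha) (by rw [inner_neg_left]; linarith)
      rw [inner_neg_left, inner_self_of_mem_roots ha] at this
      linarith)
    exact ⟨_, p, by simpa using hp 0 zero_mem_face, rfl⟩
  by_cases hb : BddBelow ((fun x => ⟪a, x⟫) '' K)
  · right
    refine ⟨sInf ((fun x => ⟪a, x⟫) '' K), Subset.antisymm
      (fun x hx => csInf_le hb ⟨x, hx, rfl⟩) fun y hy => ?_⟩
    refine hclosed.mem_of_tendsto (tendsto_add_smul y a) ?_
    filter_upwards [self_mem_nhdsWithin] with ε hε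
    have hε : (0 : ℝ) < ε := hε
    have hy : sInf ((fun x => ⟪a, x⟫) '' K) ≤ ⟪a, y⟫ := hy
    obtain ⟨_, ⟨x, hx, rfl⟩, hxy⟩ := exists_lt_of_csInf_lt hne
      (show sInf ((fun x => ⟪a, x⟫) '' K) < ⟪a, y + ε • a⟫ by
        rw [inner_add_right, inner_smul_right, inner_self_of_mem_roots ha]; linarith)
    exact hadd x hx _ hxy.le
  · left
    rw [eq_univ_iff_forall]
    intro y
    rw [not_bddBelow_iff] at hb
    obtain ⟨_, ⟨x, hx, rfl⟩, hxy⟩ := hb ⟪a, y⟫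
    exact hadd x hx y hxy.le

end RBuilding

end ConeAtInfinity

section Walls

open scoped RealInnerProductSpace
open Filter Topology SphericalCoxeterSystem

namespace Par

variable {X : Type*} [MetricSpace X] {S T U : Set X}

theorem symm (h : Par S T) : Par T S := by
  change Metric.hausdorffEDist T S ≠ ⊤
  rw [Metric.hausdorffEDist_comm]
  exact h

theorem trans (h : Par S T) (h' : Par T U) : Par S U :=
  ne_top_of_le_ne_top (ENNReal.add_ne_top.mpr ⟨h, h'⟩) Metric.hausdorffEDist_triangle

theorem of_dist_le {ι : Type*} {Z : Set ι} {f g : ι → X} {C : ℝ}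
    (hC : ∀ x ∈ Z, dist (f x) (g x) ≤ C) : Par (f '' Z) (g '' Z) := by
  refine ne_top_of_le_ne_top (b := ENNReal.ofReal C) ENNReal.ofReal_ne_top
    (Metric.hausdorffEDist_le_of_mem_edist ?_ ?_)
  · rintro _ ⟨x, hx, rfl⟩
    exact ⟨g x, ⟨x, hx, rfl⟩, by rw [edist_dist]; exact ENNReal.ofReal_le_ofReal (hC x hx)⟩
  · rintro _ ⟨x, hx, rfl⟩
    exact ⟨f x, ⟨x, hx, rfl⟩, by
      rw [edist_dist, dist_comm]; exact ENNReal.ofReal_le_ofReal (hC x hx)⟩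

theorem exists_dist_le (h : Par S T) : ∃ C, ∀ x ∈ S, ∃ y ∈ T, dist x y ≤ C := by
  have hlt : Metric.hausdorffEDist S T < Metric.hausdorffEDist S T + 1 :=
    ENNReal.lt_add_right h one_ne_zero
  refine ⟨(Metric.hausdorffEDist S T + 1).toReal, fun x hx => ?_⟩
  obtain ⟨y, hy, hxy⟩ := Metric.exists_edist_lt_of_hausdorffEDist_lt hx hlt
  refine ⟨y, hy, ?_⟩
  rw [dist_edist]
  exact ENNReal.toReal_mono (ENNReal.add_ne_top.mpr ⟨h, ENNReal.one_ne_top⟩) hxy.le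

end Par

namespace SphericalCoxeterSystem

variable {n : ℕ} {cs : SphericalCoxeterSystem n} {ξ η ζ a x y : ModelSpace n}
  {l : ModelSpace n ≃ₗᵢ[ℝ] ModelSpace n}

theorem inner_map_eq_inner_symm (l : ModelSpace n ≃ₗᵢ[ℝ] ModelSpace n) (x y : ModelSpace n) :
    ⟪x, l y⟫ = ⟪l.symm x, y⟫ := by
  rw [← l.inner_map_map (l.symm x), l.apply_symm_apply]

theorem IsPanelVector.inner_add_smul (hp : cs.IsPanelVector ξ a) (ε : ℝ) :
    ⟪a, ξ + ε • a⟫ = ε := by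
  rw [inner_add_right, hp.inner_eq_zero, inner_smul_right, inner_self_of_mem_roots hp.mem]; ring

theorem IsPanelVector.map (hp : cs.IsPanelVector ξ a) (hl : l ∈ cs.linW) :
    cs.IsPanelVector (l ξ) (l a) where
  mem := map_mem_roots hp.mem hl
  inner_eq_zero := by rw [l.inner_map_map, hp.inner_eq_zero]
  eq_or_eq_neg b hb h := by
    rw [inner_map_eq_inner_symm] at h
    rcases hp.eq_or_eq_neg _ (map_mem_roots hb (symm_mem_linW hl)) h with h | h
    · left; rw [← h, l.apply_symm_apply]
    · right; rw [← map_neg, ← h, l.apply_symm_apply]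

theorem IsPanelVector.isModelSectorPanel (hp : cs.IsPanelVector ξ a) (x : ModelSpace n) :
    cs.IsModelSectorPanel x {y | y - x ∈ cs.face ξ} := by
  refine ⟨isModelSectorFace_iff.mpr ⟨ξ, rfl⟩, ?_⟩
  have ha0 : a ≠ 0 := by
    rintro rfl
    have := hp.mem.1
    rw [norm_zero] at this
    exact zero_ne_one this
  have hspan : Submodule.span ℝ (cs.face ξ) = (Submodule.span ℝ {a})ᗮ := by
    apply le_antisymm
    · rw [Submodule.span_le]
      exact fun y hy => Submodule.mem_orthogonal_singleton_iff_inner_right.mpr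
        (hp.inner_eq_zero_of_mem hy)
    · intro y hy
      obtain ⟨p, hp, q, hq, rfl⟩ :=
        hp.exists_sub_mem (Submodule.mem_orthogonal_singleton_iff_inner_right.mp hy)
      exact Submodule.sub_mem _ (Submodule.subset_span hp) (Submodule.subset_span hq)
  have hn : n ≠ 0 := by
    rintro rfl
    exact ha0 (Subsingleton.elim _ _)
  have : Fact (Module.finrank ℝ (ModelSpace n) = (n - 1) + 1) := ⟨by
    rw [finrank_euclideanSpace_fin]; omega⟩
  rw [direction_affineSpan_face, hspan, Submodule.finrank_orthogonal_span_singleton (n := n - 1) ha0]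

theorem face_subset_of_dist_le {C : ℝ}
    (h : ∀ x ∈ cs.face η, ∃ y ∈ cs.face ζ, dist x y ≤ C) : cs.face η ⊆ cs.face ζ := by
  intro x hx b hb hbζ
  by_contra hneg
  push Not at hneg
  obtain ⟨t, ht⟩ := exists_nat_gt (C / -⟪b, x⟫)
  rw [div_lt_iff₀ (by linarith)] at ht
  obtain ⟨y, hy, hxy⟩ := h ((t : ℝ) • x) (smul_mem_face t.cast_nonneg hx)
  have h1 := hy b hb hbζ
  have h2 := real_inner_le_norm b (y - (t : ℝ) • x)
  rw [hb.1, one_mul, ← dist_eq_norm, dist_comm, inner_sub_right, inner_smul_right] at h2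
  linarith

theorem mem_of_convex_of_hyperplane {K : Set (ModelSpace n)} (hK : Convex ℝ K)
    {v : ModelSpace n}
    (ha : ∀ x, ⟪a, x⟫ = 0 → x ∈ K) (hv : 0 < ⟪a, v⟫) (hvK : ∀ s : ℝ, 0 ≤ s → s • v ∈ K)
    (hx : 0 ≤ ⟪a, x⟫) : x ∈ K := by
  have h1 := ha ((2 : ℝ) • (x - (⟪a, x⟫ / ⟪a, v⟫) • v)) (by
    rw [inner_smul_right, inner_sub_right, inner_smul_right, div_mul_cancel₀ _ hv.ne', sub_self,
      mul_zero])
  have h2 := hvK (2 * (⟪a, x⟫ / ⟪a, v⟫)) (by positivity)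
  have h3 := hK h1 h2 (a := 1 / 2) (b := 1 / 2) (by norm_num) (by norm_num) (by norm_num)
  have h4 : (1 / 2 : ℝ) • ((2 : ℝ) • (x - (⟪a, x⟫ / ⟪a, v⟫) • v)) +
      (1 / 2 : ℝ) • ((2 * (⟪a, x⟫ / ⟪a, v⟫)) • v) = x := by module
  rwa [h4] at h3

theorem IsPanelVector.mem_of_convex {K : Set (ModelSpace n)} (hp : cs.IsPanelVector ξ a)
    (hK : Convex ℝ K) (h : ∀ x ∈ cs.face ξ, x ∈ K) (h' : ∀ x ∈ cs.face ξ, -x ∈ K)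
    (hx : ⟪a, x⟫ = 0) : x ∈ K := by
  obtain ⟨p, hp, q, hq, rfl⟩ := hp.exists_sub_mem hx
  have h3 := hK (h _ (smul_mem_face zero_le_two hp)) (h' _ (smul_mem_face zero_le_two hq))
    (a := 1 / 2) (b := 1 / 2) (by norm_num) (by norm_num) (by norm_num)
  have h4 : (1 / 2 : ℝ) • ((2 : ℝ) • p) + (1 / 2 : ℝ) • (-((2 : ℝ) • q)) = p - q := by module
  rwa [h4] at h3

end SphericalCoxeterSystem

namespace RBuilding

variable {n : ℕ} {cs : SphericalCoxeterSystem n} {X : Type*} [MetricSpace X] {Λ : Set X}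
  (B : RBuilding cs X Λ) {ξ η a x y : ModelSpace n} {l : ModelSpace n ≃ₗᵢ[ℝ] ModelSpace n}

theorem image_eq_image_chartComp (f : B.charts) (x ξ : ModelSpace n) :
    f.1 '' {y | y - x ∈ cs.face ξ} =
      (B.chartComp f (refl_mem_linW (cs := cs)) x).1 '' cs.face ξ := by
  ext z
  constructor
  · rintro ⟨y, hy, rfl⟩
    exact ⟨y - x, hy, congrArg f.1 (sub_add_cancel y x)⟩
  · rintro ⟨y, hy, rfl⟩
    exact ⟨y + x, by simpa using hy, rfl⟩

theorem exists_chart_panel (hroots : cs.roots.Nonempty) {P : Set X}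
    (hP : IsSectorPanel cs B.charts P) :
    ∃ f : B.charts, ∃ ξ a, cs.IsPanelVector ξ a ∧ P = f.1 '' cs.face ξ := by
  obtain ⟨_, f, hf, x, s, hs, -, rfl⟩ := hP
  obtain ⟨ξ, a, hp, rfl⟩ := exists_panelVector hs hroots
  exact ⟨_, ξ, a, hp, B.image_eq_image_chartComp ⟨f, hf⟩ x ξ⟩

theorem isSectorPanel_image (f : B.charts) (hp : cs.IsPanelVector ξ a) :
    IsSectorPanel cs B.charts (f.1 '' cs.face ξ) :=
  ⟨_, f, f.2, 0, _, hp.isModelSectorPanel 0, rfl, by simp⟩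

theorem isWall_image (f : B.charts) (ha : a ∈ cs.roots) :
    IsWall cs B.charts (f.1 '' {x | ⟪a, x⟫ = 0}) :=
  ⟨f, f.2, _, isModelWall_iff.mpr ⟨a, ha, 0, rfl⟩, rfl⟩

theorem exists_chart_wall (g : B.charts) (hp : cs.IsPanelVector ξ a) {M : Set X}
    (hM : IsWall cs B.charts M) (hsub : g.1 '' cs.face ξ ⊆ M) :
    ∃ f : B.charts, (∀ y ∈ cs.face ξ, f.1 y = g.1 y) ∧ M = f.1 '' {x | ⟪a, x⟫ = 0} := by
  obtain ⟨f, hf, m, hm, rfl⟩ := hM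
  obtain ⟨b, hb, c, rfl⟩ := isModelWall_iff.mp hm
  obtain ⟨l, hl, u, hlu⟩ := B.exists_transition g ⟨f, hf⟩
  have key : ∀ y ∈ cs.face ξ, g.1 y = f (l y + u) ∧ ⟪b, l y + u⟫ = c := by
    intro y hy
    obtain ⟨z, hz, hzy⟩ := hsub ⟨y, hy, rfl⟩
    have h1 := hlu y ⟨z, hzy⟩
    refine ⟨h1, ?_⟩
    rw [← B.chart_injective ⟨f, hf⟩ (hzy.trans h1)]
    exact hz
  have hc : ⟪b, u⟫ = c := by
    have := (key 0 zero_mem_face).2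
    rwa [map_zero, zero_add] at this
  have hiff : ∀ y, ⟪b, l y + u⟫ = c ↔ ⟪a, y⟫ = 0 := by
    have hl0 : ∀ y, ⟪b, l y + u⟫ = c ↔ ⟪l.symm b, y⟫ = 0 := fun y => by
      rw [inner_add_right, hc, add_eq_right, inner_map_eq_inner_symm]
    intro y
    rw [hl0]
    rcases hp.eq_or_eq_neg _ (map_mem_roots hb (symm_mem_linW hl))
      ((hl0 ξ).mp (key ξ self_mem_face).2) with h | h
    · rw [h]
    · rw [h, inner_neg_left, neg_eq_zero]
  refine ⟨B.chartComp ⟨f, hf⟩ hl u, fun y hy => (key y hy).1.symm, ?_⟩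
  ext z
  constructor
  · rintro ⟨y, hy, rfl⟩
    have hy' : l (l.symm (y - u)) + u = y := by simp
    refine ⟨l.symm (y - u), (hiff _).mp (by rw [hy']; exact hy), ?_⟩
    rw [chartComp_apply, hy']
  · rintro ⟨y, hy, rfl⟩
    exact ⟨l y + u, (hiff y).mpr hy, rfl⟩

theorem cone_eq_of_eq_on_face (f h : B.charts) (he : ∀ x ∈ cs.face ξ, f.1 x = h.1 x) :
    ∀ x ∈ cs.face ξ, B.cone f x = B.cone h x := fun x hx =>
  B.cone_eq_of_dist_le _ _ (C := 0) fun t ht => by rw [he _ (smul_mem_face ht hx), dist_self]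

theorem exists_chart_of_par (g f : B.charts) (hpar : Par (g.1 '' cs.face η) (f.1 '' cs.face ξ)) :
    ∃ g' : B.charts, g'.1 '' cs.face ξ = g.1 '' cs.face η ∧
      ∀ x ∈ cs.face ξ, B.cone g' x = B.cone f x := by
  obtain ⟨v, hv, hξv⟩ := cs.exists_generic_face_superset ξ
  obtain ⟨w, hw, hηw⟩ := cs.exists_generic_face_superset η
  obtain ⟨k, l, hl, C, h1, h2⟩ := B.exists_coarse_chart f g hv hw
  have hdist : ∀ x ∈ cs.face ξ, ∀ y ∈ cs.face η,
      dist x (l y) ≤ C + dist (f.1 x) (g.1 y) + C := by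
    intro x hx y hy
    have e1 := h1 x (hξv hx)
    have e2 := h2 y (hηw hy)
    rw [← B.dist_chart k]
    have := dist_triangle4 (k.1 x) (f.1 x) (g.1 y) (k.1 (l y))
    rw [dist_comm (k.1 x) (f.1 x)] at this
    linarith
  have hface : cs.face ξ = cs.face (l η) := by
    apply Subset.antisymm
    · obtain ⟨D, hD⟩ := hpar.symm.exists_dist_le
      refine face_subset_of_dist_le (C := C + D + C) fun x hx => ?_
      obtain ⟨_, ⟨y, hy, rfl⟩, hxy⟩ := hD _ ⟨x, hx, rfl⟩
      exact ⟨l y, map_mem_face hl hy, by linarith [hdist x hx y hy]⟩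
    · obtain ⟨D, hD⟩ := hpar.exists_dist_le
      refine face_subset_of_dist_le (C := C + D + C) fun y hy => ?_
      have hy' : l.symm y ∈ cs.face η := (map_mem_face_iff hl).mp (by simpa using hy)
      obtain ⟨_, ⟨x, hx, rfl⟩, hxy⟩ := hD _ ⟨_, hy', rfl⟩
      have := hdist x hx _ hy'
      rw [l.apply_symm_apply, dist_comm (f.1 x)] at this
      exact ⟨x, hx, by rw [dist_comm]; linarith⟩
  have hsymm : ∀ x ∈ cs.face ξ, l.symm x ∈ cs.face η := fun x hx =>
    (map_mem_face_iff hl).mp (by rw [l.apply_symm_apply, ← hface]; exact hx)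
  refine ⟨B.chartComp g (symm_mem_linW hl) 0, ?_, fun x hx => ?_⟩
  · ext z
    constructor
    · rintro ⟨x, hx, rfl⟩
      exact ⟨l.symm x, hsymm x hx, by rw [chartComp_apply, add_zero]⟩
    · rintro ⟨y, hy, rfl⟩
      refine ⟨l y, by rw [hface]; exact map_mem_face hl hy, ?_⟩
      rw [chartComp_apply, add_zero, l.symm_apply_apply]
  · have e1 : B.cone f x = B.cone k x :=
      B.cone_eq_of_dist_le _ _ fun t ht => h1 _ (smul_mem_face ht (hξv hx))
    have e2 : B.cone g (l.symm x) = B.cone k x := B.cone_eq_of_dist_le _ _ (C := C) fun t ht => by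
      have := h2 _ (smul_mem_face ht (hηw (hsymm x hx)))
      rwa [map_smul, l.apply_symm_apply] at this
    rw [B.cone_chartComp, e1, e2]

/-- A panel of a given direction extends, after shrinking, to a wall parallel to a given wall
containing a panel of the same direction. -/
theorem exists_wall_chart (f f₁ : B.charts) (hp : cs.IsPanelVector ξ a)
    (he : ∀ x ∈ cs.face ξ, B.cone f₁ x = B.cone f x) :
    ∃ h : B.charts, ∃ q ∈ cs.face ξ, (∀ x ∈ cs.face ξ, f.1 (q + x) = h.1 x) ∧
      ∀ x, ⟪a, x⟫ = 0 → B.cone h x = B.cone f₁ x := by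
  obtain ⟨ε, hε, hv, hv', hsub, hsub'⟩ := hp.exists_generic
  obtain ⟨ρ, hρ, hρx⟩ := exists_reflection hp.mem
  have hav : ⟪a, ξ + ε • a⟫ = ε := hp.inner_add_smul ε
  obtain ⟨_, ⟨h, rfl⟩, hh1, hh2, hh3⟩ := B.isConeSystem_range_cone.exists_join
    (mem_range_self f) (mem_range_self f₁) (mem_range_self f) hp hv hv' hsub hsub' hρ hρx
    he (fun _ _ => rfl) (fun hall => by
      have h1 := (B.isometry_cone f).injective (hall _ self_mem_face)
      have h2 : ⟪a, ξ + ε • a⟫ = ⟪a, ρ (ξ + ε • a)⟫ := by rw [← h1]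
      rw [hρx, inner_sub_right, inner_smul_right, inner_self_of_mem_roots hp.mem, hav] at h2
      linarith)
  have hha : ∀ x, ⟪a, x⟫ = 0 → B.cone h x = B.cone f₁ x := fun x hx =>
    hp.mem_of_convex (B.isConeSystem_range_cone.convex_eq (mem_range_self h) (mem_range_self f₁))
      (fun x hx => (hh1 x (hsub hx)).trans (he x hx).symm) hh3 hx
  obtain ⟨p₁, τ, hp₁, hτ⟩ := B.exists_translate_of_cone_eq f h hv fun x hx => (hh1 x hx).symm
  obtain ⟨p₂, -, hp₂, -⟩ := B.exists_translate_of_cone_eq f h hv' fun x hx => (hh2 x hx).symm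
  obtain ⟨-, hconv, -⟩ := B.A2 f f.2 h h.2
  obtain ⟨N, ⟨hN₁, hN₂⟩, hN⟩ := ((hv.eventually_smul_add_mem_face (-p₁)).and
    (hv'.eventually_smul_add_mem_face (-p₂))).and (eventually_ge_atTop 0) |>.exists
  have hmem : ∀ x ∈ cs.face ξ, f.1 (N • ξ + x) ∈ range h.1 := by
    intro x hx
    have h1 := hp₁ _ (add_mem_face hN₁ (hsub hx))
    have h2 := hp₂ _ (add_mem_face hN₂ (hsub' hx))
    have h3 := hconv h1 h2 (a := 1 / 2) (b := 1 / 2) (by norm_num) (by norm_num) (by norm_num)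
    have h4 : (1 / 2 : ℝ) • (p₁ + (N • (ξ + ε • a) + -p₁ + x)) +
        (1 / 2 : ℝ) • (p₂ + (N • (ξ - ε • a) + -p₂ + x)) = N • ξ + x := by module
    rwa [h4] at h3
  refine ⟨B.chartComp h refl_mem_linW (N • ξ + τ), N • ξ, smul_mem_face hN self_mem_face,
    fun x hx => ?_, fun x hx => ?_⟩
  · rw [hτ _ (hmem x hx), chartComp_apply]
    exact congrArg h.1 (show N • ξ + x + τ = x + (N • ξ + τ) by abel)
  · rw [B.cone_chartComp, ← hha x hx]
    rfl

theorem cone_eq_of_par (f f' : B.charts) (hp : cs.IsPanelVector ξ a)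
    (hpar : Par (f.1 '' {x | ⟪a, x⟫ = 0}) (f'.1 '' {x | ⟪a, x⟫ = 0}))
    (he : ∀ x ∈ cs.face ξ, B.cone f x = B.cone f' x) (hx : ⟪a, x⟫ = 0) :
    B.cone f x = B.cone f' x := by
  obtain ⟨C, hC⟩ := hpar.exists_dist_le
  obtain ⟨D, hD⟩ := B.exists_dist_le_of_cone_eq f f' he
  have hy : ∀ t : ℝ, ∃ y, dist (f.1 (t • x)) (f'.1 y) ≤ C := fun t => by
    obtain ⟨_, ⟨y, -, rfl⟩, hy⟩ := hC _ ⟨t • x, by rw [mem_ofPred_eq, inner_smul_right, hx,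
      mul_zero], rfl⟩
    exact ⟨y, hy⟩
  choose y hy using hy
  have hdist : ∀ z ∈ cs.face ξ,
      Tendsto (fun t : ℝ => dist (t⁻¹ • y t) z) atTop (𝓝 (dist x z)) := by
    intro z hz
    have h1 : Tendsto (fun t : ℝ => dist (y t) (t • z) / t) atTop (𝓝 (dist x z)) := by
      refine tendsto_div_of_abs_sub_le (C := C + D) fun t ht => ?_
      have e1 := dist_dist_dist_le (f'.1 (y t)) (f'.1 (t • z)) (f.1 (t • x)) (f.1 (t • z))
      rw [B.dist_chart, B.dist_chart, dist_smul₀, Real.norm_of_nonneg ht, Real.dist_eq,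
        dist_comm (f'.1 (y t)), dist_comm (f'.1 (t • z))] at e1
      linarith [hy t, hD _ (smul_mem_face ht hz)]
    refine h1.congr' ?_
    filter_upwards [eventually_gt_atTop 0] with t ht
    rw [← inv_smul_smul₀ ht.ne' z, dist_smul₀, norm_inv, Real.norm_of_nonneg ht.le,
      smul_inv_smul₀ ht.ne', div_eq_inv_mul]
  have hnorm : Tendsto (fun t : ℝ => ‖t⁻¹ • y t‖ ^ 2) atTop (𝓝 (‖x‖ ^ 2)) := by
    have := (hdist 0 zero_mem_face).pow 2
    simpa only [dist_zero_right] using this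
  have hinner : ∀ z ∈ cs.face ξ, Tendsto (fun t : ℝ => ⟪t⁻¹ • y t, z⟫) atTop (𝓝 ⟪x, z⟫) := by
    intro z hz
    have h1 := ((hnorm.add_const (‖z‖ ^ 2)).sub ((hdist z hz).pow 2)).div_const 2
    have h2 : ∀ u : ModelSpace n, (‖u‖ ^ 2 + ‖z‖ ^ 2 - dist u z ^ 2) / 2 = ⟪u, z⟫ := fun u => by
      rw [dist_eq_norm, norm_sub_sq_real]; ring
    simpa only [h2] using h1
  have hlim : Tendsto (fun t : ℝ => ‖t⁻¹ • y t - x‖) atTop (𝓝 0) := by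
    obtain ⟨p, hp, q, hq, hpq⟩ := hp.exists_sub_mem hx
    have h1 : Tendsto (fun t : ℝ => ⟪t⁻¹ • y t, x⟫) atTop (𝓝 ⟪x, x⟫) := by
      have h2 := (hinner p hp).sub (hinner q hq)
      simp only [← inner_sub_right] at h2
      rwa [← hpq] at h2
    have h2 := ((hnorm.sub (h1.const_mul 2)).add_const (‖x‖ ^ 2)).sqrt
    rw [real_inner_self_eq_norm_sq, show ‖x‖ ^ 2 - 2 * ‖x‖ ^ 2 + ‖x‖ ^ 2 = 0 by ring,
      Real.sqrt_zero] at h2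
    refine h2.congr fun t => ?_
    rw [← norm_sub_sq_real, Real.sqrt_sq (norm_nonneg _)]
  have hzero : Tendsto (fun t : ℝ => dist (f.1 (t • x)) (f'.1 (t • x)) / t) atTop (𝓝 0) := by
    refine squeeze_zero' (g := fun t : ℝ => C / t + ‖t⁻¹ • y t - x‖) ?_ ?_ ?_
    · filter_upwards [eventually_gt_atTop 0] with t ht
      positivity
    · filter_upwards [eventually_gt_atTop 0] with t ht
      have e1 : ‖t⁻¹ • y t - x‖ = dist (y t) (t • x) / t := by
        nth_rewrite 1 [← inv_smul_smul₀ ht.ne' x]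
        rw [← dist_eq_norm, dist_smul₀, norm_inv, Real.norm_of_nonneg ht.le, div_eq_inv_mul]
      rw [e1, ← add_div]
      gcongr
      have := dist_triangle (f.1 (t • x)) (f'.1 (y t)) (f'.1 (t • x))
      rw [B.dist_chart f'] at this
      linarith [hy t]
    · simpa using (tendsto_const_nhds (x := C).div_atTop tendsto_id).add hlim
  exact dist_eq_zero.mp (tendsto_nhds_unique (B.tendsto_dist_cone f f' x x) hzero)

end RBuilding

end Walls

section Uniqueness

open scoped RealInnerProductSpace
open SphericalCoxeterSystem

namespace RBuilding

variable {n : ℕ} {cs : SphericalCoxeterSystem n} {X : Type*} [MetricSpace X] {Λ : Set X}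
  (B : RBuilding cs X Λ) {ξ a : ModelSpace n}

theorem cone_eq_of_nonneg (f h : B.charts) {v : ModelSpace n}
    (he : ∀ x, ⟪a, x⟫ = 0 → B.cone f x = B.cone h x) (hv : 0 < ⟪a, v⟫)
    (hev : ∀ x ∈ cs.face v, B.cone f x = B.cone h x) {x : ModelSpace n} (hx : 0 ≤ ⟪a, x⟫) :
    B.cone f x = B.cone h x :=
  mem_of_convex_of_hyperplane
    (B.isConeSystem_range_cone.convex_eq (mem_range_self f) (mem_range_self h)) he hv
    (fun _ hs => hev _ (smul_mem_face hs self_mem_face)) hx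

theorem isHalfApartment_inter (f g : B.charts) (ha : a ∈ cs.roots) {c : ℝ}
    (h : {x | f.1 x ∈ range g.1} = {x | c ≤ ⟪a, x⟫}) :
    IsHalfApartment cs B.charts (range f.1 ∩ range g.1) := by
  refine ⟨f, f.2, _, _, isModelHalf_ge ha c, ?_⟩
  rw [← h]
  ext z
  constructor
  · rintro ⟨⟨x, rfl⟩, hx⟩
    exact ⟨x, hx, rfl⟩
  · rintro ⟨x, hx, rfl⟩
    exact ⟨⟨x, rfl⟩, hx⟩

/-- Two charts whose cones at infinity agree on one side of a wall agree on that wall up to a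
translation, unless they only meet strictly beyond it. -/
theorem exists_translate_or_exists_lt (f g : B.charts) (ha : a ∈ cs.roots)
    (he : ∀ x, 0 ≤ ⟪a, x⟫ → B.cone f x = B.cone g x) :
    (∃ τ, ∀ x, ⟪a, x⟫ = 0 → f.1 x = g.1 (x + τ)) ∨
      ∃ c > 0, {x | f.1 x ∈ range g.1} = {x | c ≤ ⟪a, x⟫} := by
  obtain ⟨v, hv, hav⟩ := exists_generic_mem_face (cs := cs) a
  have hav : 0 ≤ ⟪a, v⟫ := by
    by_contra! hneg
    have h1 := hav (-a) (neg_mem_roots ha) (by rw [inner_neg_left]; linarith)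
    rw [inner_neg_left, inner_self_of_mem_roots ha] at h1
    linarith
  obtain ⟨-, τ, -, hτ⟩ := B.exists_translate_of_cone_eq f g hv fun x hx => he x (hx a ha hav)
  rcases B.setOf_mem_range_eq_of_cone_eq f g ha he with h | ⟨c, h⟩
  · exact .inl ⟨τ, fun x _ => hτ x ((Set.ext_iff.mp h x).mpr (mem_univ x))⟩
  · rcases le_or_gt c 0 with hc | hc
    · exact .inl ⟨τ, fun x hx => hτ x ((Set.ext_iff.mp h x).mpr (by
        rw [mem_ofPred_eq, hx]; exact hc))⟩
    · exact .inr ⟨c, hc, h⟩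

/-- Given two charts whose cones at infinity agree on a wall, there is a chart whose cone agrees
with the first on one side of the wall and with the second on a chamber on the other side. -/
theorem exists_chart_cone_eq (f f' : B.charts) (hp : cs.IsPanelVector ξ a)
    (he : ∀ x, ⟪a, x⟫ = 0 → B.cone f x = B.cone f' x) {ε : ℝ} (hε : 0 < ε)
    (hv : cs.Generic (ξ + ε • a)) (hv' : cs.Generic (ξ - ε • a))
    (hsub : cs.face ξ ⊆ cs.face (ξ + ε • a)) (hsub' : cs.face ξ ⊆ cs.face (ξ - ε • a))
    {ρ : ModelSpace n ≃ₗᵢ[ℝ] ModelSpace n} (hρ : ρ ∈ cs.linW)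
    (hρx : ∀ x, ρ x = x - (2 * ⟪a, x⟫) • a)
    (hne : ¬ ∀ x ∈ cs.face (ξ + ε • a), B.cone f' x = B.cone f (ρ x)) :
    ∃ g : B.charts, (∀ x ∈ cs.face (ξ + ε • a), B.cone g x = B.cone f' x) ∧
      ∀ x, 0 ≤ ⟪-a, x⟫ → B.cone f x = B.cone g x := by
  have heξ : ∀ x ∈ cs.face ξ, B.cone f x = B.cone f' x := fun x hx =>
    he x (hp.inner_eq_zero_of_mem hx)
  obtain ⟨_, ⟨g, rfl⟩, hg1, hg2, hg3⟩ := B.isConeSystem_range_cone.exists_join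
    (mem_range_self f') (mem_range_self f) (mem_range_self f) hp hv hv' hsub hsub' hρ hρx
    heξ heξ hne
  refine ⟨g, hg1, fun x hx => B.cone_eq_of_nonneg f g (v := ξ - ε • a) (fun x hx => ?_) ?_
    (fun x hx => (hg2 x hx).symm) hx⟩
  · rw [inner_neg_left, neg_eq_zero] at hx
    exact hp.mem_of_convex
      (B.isConeSystem_range_cone.convex_eq (mem_range_self f) (mem_range_self g))
      (fun x hx => (hg2 x (hsub' hx)).symm) (fun x hx => (hg3 x hx).symm) hx
  · rw [inner_neg_left, sub_eq_add_neg, ← neg_smul, hp.inner_add_smul]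
    linarith

/-- If the cones at infinity of `f` and `f'` agree on a wall, then a chart equal to `f` on that
wall has a cone agreeing with that of `f'` on a chamber adjacent to the wall. -/
theorem exists_chart_eq_on_wall (f f' : B.charts) (hp : cs.IsPanelVector ξ a)
    (he : ∀ x, ⟪a, x⟫ = 0 → B.cone f x = B.cone f' x) :
    ∃ h : B.charts, ∃ v, 0 < ⟪a, v⟫ ∧ (∀ x, ⟪a, x⟫ = 0 → h.1 x = f.1 x) ∧
      ∀ x ∈ cs.face v, B.cone h x = B.cone f' x := by
  obtain ⟨ε, hε, hv, hv', hsub, hsub'⟩ := hp.exists_generic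
  obtain ⟨ρ, hρ, hρx⟩ := exists_reflection hp.mem
  have hav : 0 < ⟪a, ξ + ε • a⟫ := by rwa [hp.inner_add_smul]
  have hρa : ∀ x, ⟪a, ρ x⟫ = -⟪a, x⟫ := fun x => by
    rw [hρx, inner_sub_right, inner_smul_right, inner_self_of_mem_roots hp.mem]; ring
  have hρρ : ∀ x, ρ (ρ x) = x := fun x => by
    rw [hρx (ρ x), hρa, hρx]; module
  have hρ0 : ∀ x, ⟪a, x⟫ = 0 → ρ x = x := fun x hx => by rw [hρx, hx]; module
  set k := B.chartComp f hρ 0 with hk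
  have hkx : ∀ x, k.1 x = f.1 (ρ x) := fun x => by rw [hk, chartComp_apply, add_zero]
  have hkc : ∀ x, B.cone k x = B.cone f (ρ x) := fun x => B.cone_chartComp ..
  by_cases hA : ∀ x ∈ cs.face (ξ + ε • a), B.cone f' x = B.cone f x
  · exact ⟨f, _, hav, fun _ _ => rfl, fun x hx => (hA x hx).symm⟩
  by_cases hB : ∀ x ∈ cs.face (ξ + ε • a), B.cone f' x = B.cone f (ρ x)
  · exact ⟨k, _, hav, fun x hx => by rw [hkx, hρ0 x hx],
      fun x hx => by rw [hkc, hB x hx]⟩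
  have hek : ∀ x, ⟪a, x⟫ = 0 → B.cone k x = B.cone f' x := fun x hx => by
    rw [hkc, hρ0 x hx, he x hx]
  obtain ⟨g₁, hg₁, hg₁f⟩ := B.exists_chart_cone_eq f f' hp he hε hv hv' hsub hsub' hρ hρx hB
  obtain ⟨g₂, hg₂, hg₂k⟩ := B.exists_chart_cone_eq k f' hp hek hε hv hv' hsub hsub' hρ hρx
    (by simpa only [hkc, hρρ] using hA)
  have ha' := neg_mem_roots hp.mem
  have hneg : ∀ x, ⟪a, x⟫ = 0 → ⟪-a, x⟫ = 0 := fun x hx => by rw [inner_neg_left, hx, neg_zero]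
  rcases B.exists_translate_or_exists_lt f g₁ ha' hg₁f with ⟨τ, hτ⟩ | ⟨c₁, hc₁, h₁⟩
  · exact ⟨B.chartComp g₁ refl_mem_linW τ, _, hav, fun x hx => (hτ x (hneg x hx)).symm,
      fun x hx => (B.cone_chartComp ..).trans (hg₁ x hx)⟩
  rcases B.exists_translate_or_exists_lt k g₂ ha' hg₂k with ⟨τ, hτ⟩ | ⟨c₂, hc₂, h₂⟩
  · refine ⟨B.chartComp g₂ refl_mem_linW τ, _, hav, fun x hx => ?_,
      fun x hx => (B.cone_chartComp ..).trans (hg₂ x hx)⟩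
    rw [← hρ0 x hx, ← hkx, hρ0 x hx]
    exact (hτ x (hneg x hx)).symm
  exfalso
  have h₂' : {x | f.1 x ∈ range g₂.1} = {x | c₂ ≤ ⟪a, x⟫} := by
    ext x
    have := Set.ext_iff.mp h₂ (ρ x)
    simpa only [mem_ofPred_eq, hkx, hρρ, inner_neg_left, hρa, neg_neg] using this
  have h₁' : ∀ x, f.1 x ∈ range g₁.1 ↔ ⟪a, x⟫ ≤ -c₁ := fun x => by
    have := Set.ext_iff.mp h₁ x
    simp only [mem_ofPred_eq, inner_neg_left] at this
    rw [this, le_neg]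
  have hdisj : ∀ x, f.1 x ∈ range g₁.1 → f.1 x ∉ range g₂.1 := fun x hx hx' => by
    have e1 := (h₁' x).mp hx
    have e2 : c₂ ≤ ⟪a, x⟫ := (Set.ext_iff.mp h₂' x).mp hx'
    linarith
  have hg : ∀ x, 0 ≤ ⟪a, x⟫ → B.cone g₁ x = B.cone g₂ x := fun x hx =>
    B.cone_eq_of_nonneg g₁ g₂ (fun x hx => by
      rw [← hg₁f x (hneg x hx).ge,
        ← hg₂k x (hneg x hx).ge, he x hx, hek x hx]) hav
      (fun x hx => by rw [hg₁ x hx, hg₂ x hx]) hx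
  rcases B.setOf_mem_range_eq_of_cone_eq g₁ g₂ hp.mem hg with h₃ | ⟨c₃, h₃⟩
  · have hx : f.1 ((-c₁) • a) ∈ range g₁.1 := (h₁' _).mpr (by
      rw [inner_smul_right, inner_self_of_mem_roots hp.mem, mul_one])
    obtain ⟨y, hy⟩ := id hx
    exact hdisj _ hx (hy ▸ (Set.ext_iff.mp h₃ y).mpr (mem_univ y))
  · obtain ⟨_, ⟨⟨x, rfl⟩, hx₁⟩, hx₂⟩ := B.A5 f f.2 g₁ g₁.2 g₂ g₂.2
      (B.isHalfApartment_inter f g₁ ha' h₁) (B.isHalfApartment_inter g₁ g₂ hp.mem h₃)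
      (B.isHalfApartment_inter f g₂ hp.mem h₂')
    exact hdisj x hx₁ hx₂

/-- Walls with the same direction and a common point coincide. -/
theorem eq_on_wall (f f' : B.charts) (hp : cs.IsPanelVector ξ a) (h0 : f.1 0 = f'.1 0)
    (he : ∀ x, ⟪a, x⟫ = 0 → B.cone f x = B.cone f' x) {x : ModelSpace n} (hx : ⟪a, x⟫ = 0) :
    f.1 x = f'.1 x := by
  obtain ⟨h, v, hv, hhf, hhc⟩ := B.exists_chart_eq_on_wall f f' hp he
  have h1 : ∀ x, ⟪a, x⟫ = 0 → B.cone f' x = B.cone h x := fun x hx => by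
    rw [← he x hx]
    exact (B.cone_eq_of_dist_le _ _ (C := 0) fun t ht => by
      rw [hhf _ (by rw [inner_smul_right, hx, mul_zero]), dist_self]).symm
  have h2 : ∀ x, 0 ≤ ⟪a, x⟫ → B.cone f' x = B.cone h x := fun x hx =>
    B.cone_eq_of_nonneg f' h h1 hv (fun x hx => (hhc x hx).symm) hx
  have h3 : f'.1 0 = h.1 0 := by rw [← h0, hhf 0 (inner_zero_right a)]
  rcases B.exists_translate_or_exists_lt f' h hp.mem h2 with ⟨τ, hτ⟩ | ⟨c, hc, hX⟩
  · have hτ0 := hτ 0 (inner_zero_right a)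
    rw [h3, zero_add] at hτ0
    rw [hτ x hx, ← B.chart_injective h hτ0, add_zero, hhf x hx]
  · have := (Set.ext_iff.mp hX 0).mp ⟨0, h3.symm⟩
    rw [mem_ofPred_eq, inner_zero_right] at this
    linarith

end RBuilding

end Uniqueness

section AsymptoticClasses

open scoped RealInnerProductSpace
open SphericalCoxeterSystem

namespace RBuilding

variable {n : ℕ} {cs : SphericalCoxeterSystem n} {X : Type*} [MetricSpace X] {Λ : Set X}
  (B : RBuilding cs X Λ) {ξ a : ModelSpace n}

theorem exists_image_add_subset_of_asymptotic (f : B.charts) (hp : cs.IsPanelVector ξ a)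
    {P M : Set X} (hPM : P ⊆ M) (h : Asymptotic cs B.charts P (f.1 '' cs.face ξ)) :
    ∃ p ∈ cs.face ξ, ∀ z ∈ cs.face ξ, f.1 (p + z) ∈ M := by
  obtain ⟨Q, hQ, hQP, hQf⟩ := h
  obtain ⟨g, η, b, hη, rfl⟩ := B.exists_chart_panel ⟨a, hp.mem⟩ hQ
  obtain ⟨l, hl, p, hpξ, hpl, hsub⟩ := B.exists_of_image_face_subset (x := 0) (y := 0) f g
    (by simpa using hQf)
  have hface := face_eq_of_panel_subset hp (hη.map hl) hsub
  refine ⟨p, hpξ, fun z hz => hPM (hQP ?_)⟩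
  have hz' : l.symm z ∈ cs.face η :=
    (map_mem_face_iff hl).mp (by rw [l.apply_symm_apply, hface]; exact hz)
  have := hpl _ hz'
  rw [zero_add, zero_add, l.apply_symm_apply] at this
  exact ⟨_, hz', this⟩

/-- Parallel walls containing translates of the same sector-panel coincide. -/
theorem wall_eq_of_par (f : B.charts) (hp : cs.IsPanelVector ξ a) {M M' : Set X}
    (hM : IsWall cs B.charts M) (hM' : IsWall cs B.charts M') (hpar : Par M M')
    {p p' : ModelSpace n} (hpξ : p ∈ cs.face ξ) (hpξ' : p' ∈ cs.face ξ)
    (h : ∀ z ∈ cs.face ξ, f.1 (p + z) ∈ M) (h' : ∀ z ∈ cs.face ξ, f.1 (p' + z) ∈ M') :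
    M = M' := by
  set g := B.chartComp f refl_mem_linW (p + p') with hg
  have hgx : ∀ x, g.1 x = f.1 (x + (p + p')) := fun x => by rw [hg, chartComp_apply]; rfl
  obtain ⟨k, hk, rfl⟩ := B.exists_chart_wall g hp hM (by
    rintro _ ⟨x, hx, rfl⟩
    rw [hgx, show x + (p + p') = p + (p' + x) by abel]
    exact h _ (add_mem_face hpξ' hx))
  obtain ⟨k', hk', rfl⟩ := B.exists_chart_wall g hp hM' (by
    rintro _ ⟨x, hx, rfl⟩
    rw [hgx, show x + (p + p') = p' + (p + x) by abel]
    exact h' _ (add_mem_face hpξ hx))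
  have hkk : ∀ x ∈ cs.face ξ, k.1 x = k'.1 x := fun x hx => (hk x hx).trans (hk' x hx).symm
  refine image_congr fun x hx => B.eq_on_wall k k' hp (hkk 0 zero_mem_face) (fun x hx =>
    B.cone_eq_of_par k k' hp hpar (B.cone_eq_of_eq_on_face k k' hkk) hx) hx

end RBuilding

end AsymptoticClasses

/-- **Tits, Prop. 4.** If `π` is a panel (represented by the
sector-panel `P₀`) lying in a wall direction `m` (represented by the wall `M₀`), then
for each asymptotic class of sector-panels with direction `π` (represented by the
sector-panel `P`) there is a unique wall with direction `m` containing an element of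
that class. -/
theorem existsUnique_wall_of_asymptotic_class
    {n : ℕ} (cs : SphericalCoxeterSystem n) {X : Type*} [MetricSpace X]
    {Λ : Set X} (B : RBuilding cs X Λ)
    (M₀ : Set X) (hM₀ : IsWall cs B.charts M₀)
    (P₀ : Set X) (hP₀ : IsSectorPanel cs B.charts P₀)
    (hP₀wall : ∃ M₁, IsWall cs B.charts M₁ ∧ Par M₁ M₀ ∧ P₀ ⊆ M₁)
    (P : Set X) (hP : IsSectorPanel cs B.charts P) (hPpar : Par P P₀) :
    ∃! M : Set X, IsWall cs B.charts M ∧ Par M M₀ ∧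
      ∃ P', IsSectorPanel cs B.charts P' ∧ Asymptotic cs B.charts P' P ∧ P' ⊆ M := by
  obtain ⟨M₁, hM₁, hM₁par, hP₀M₁⟩ := hP₀wall
  have hroots : cs.roots.Nonempty := by
    obtain ⟨-, -, m, hm, -⟩ := hM₀
    obtain ⟨a, ha, -⟩ := SphericalCoxeterSystem.isModelWall_iff.mp hm
    exact ⟨a, ha⟩
  obtain ⟨f, ξ, a, hp, rfl⟩ := B.exists_chart_panel hroots hP
  refine existsUnique_of_exists_of_unique ?_ ?_
  · obtain ⟨g, η, b, -, rfl⟩ := B.exists_chart_panel hroots hP₀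
    obtain ⟨g', hg', hg'f⟩ := B.exists_chart_of_par g f hPpar.symm
    obtain ⟨f₁, hf₁, rfl⟩ := B.exists_chart_wall g' hp hM₁ (hg' ▸ hP₀M₁)
    obtain ⟨h, q, hq, hqh, hhf₁⟩ := B.exists_wall_chart f f₁ hp fun x hx =>
      (B.cone_eq_of_eq_on_face f₁ g' hf₁ x hx).trans (hg'f x hx)
    obtain ⟨C, hC⟩ := B.exists_dist_le_of_cone_eq h f₁ hhf₁
    have hPh := B.isSectorPanel_image h hp
    refine ⟨_, B.isWall_image h hp.mem, (Par.of_dist_le hC).trans hM₁par, _, hPh,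
      ⟨_, hPh, Subset.rfl, ?_⟩, image_mono fun x hx => hp.inner_eq_zero_of_mem hx⟩
    rintro _ ⟨x, hx, rfl⟩
    exact ⟨q + x, SphericalCoxeterSystem.add_mem_face hq hx, hqh x hx⟩
  · rintro M M' ⟨hM, hMpar, Q, -, hQP, hQM⟩ ⟨hM', hMpar', Q', -, hQP', hQM'⟩
    obtain ⟨p, hpξ, h⟩ := B.exists_image_add_subset_of_asymptotic f hp hQM hQP
    obtain ⟨p', hpξ', h'⟩ := B.exists_image_add_subset_of_asymptotic f hp hQM' hQP'
    exact B.wall_eq_of_par f hp hM hM' (hMpar.trans hMpar'.symm) hpξ hpξ' h h'
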